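/- There exists a constant c ≥ 1 (depending only on L and A) such that for all integers 0 ≤ n ≤ m one has c⁻¹·𝓡_n·𝓡_{m−n} ≤ 𝓡_m ≤ c·𝓡_n·𝓡_{m−n}. (Multiplicative estimate for the resistance sequence; Theorem 3.3 of the paper in the planar case.) -/

import Mathlib

open Finset
open scoped Classical

namespace Carpet

/-- The contraction map `Ψ_{(a,b)}(x,y) = ((x+a)/L, (y+b)/L)`. -/
noncomputable def Psi (L : ℕ) (p : ℕ × ℕ) (x : ℝ × ℝ) : ℝ × ℝ :=
  ((x.1 + p.1) / L, (x.2 + p.2) / L)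

/-- Words of length `n` over the alphabet `A`. -/
abbrev Word (A : Finset (ℕ × ℕ)) (n : ℕ) := Fin n → {p : ℕ × ℕ // p ∈ A}

/-- `Ψ_w = Ψ_{w₁} ∘ ⋯ ∘ Ψ_{w_n}`. -/
noncomputable def PsiW (L : ℕ) {A : Finset (ℕ × ℕ)} {n : ℕ} (w : Word A n) : ℝ × ℝ → ℝ × ℝ :=
  (List.ofFn fun i => Psi L (w i).1).foldr (· ∘ ·) id

/-- The four corners of the unit square. -/
noncomputable def V0 : Finset (ℝ × ℝ) :=
  {((0 : ℝ), (0 : ℝ)), ((1 : ℝ), (0 : ℝ)), ((1 : ℝ), (1 : ℝ)), ((0 : ℝ), (1 : ℝ))}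

/-- The level-`n` vertex set `V_n = ⋃_{w ∈ W_n} Ψ_w(V₀)`. -/
noncomputable def VN (L : ℕ) (A : Finset (ℕ × ℕ)) (n : ℕ) : Finset (ℝ × ℝ) :=
  (Finset.univ : Finset (Word A n)).biUnion fun w => V0.image (PsiW L w)

/-- Euclidean distance in the plane. -/
noncomputable def eudist (x y : ℝ × ℝ) : ℝ :=
  Real.sqrt ((x.1 - y.1) ^ 2 + (x.2 - y.2) ^ 2)

/-- `n`-adjacency: `x = Ψ_w(p)`, `y = Ψ_w(q)` with `p, q ∈ V₀`, `|p - q| = 1`. -/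
def Adj (L : ℕ) (A : Finset (ℕ × ℕ)) (n : ℕ) (x y : ℝ × ℝ) : Prop :=
  ∃ w : Word A n, ∃ p ∈ V0, ∃ q ∈ V0,
    eudist p q = 1 ∧ x = PsiW L w p ∧ y = PsiW L w q

/-- The natural graph energy `D_n(f) = Σ_{x ∼ y} (f x - f y)²`
(summing over ordered pairs and halving). -/
noncomputable def Dform (L : ℕ) (A : Finset (ℕ × ℕ)) (n : ℕ) (f : ℝ × ℝ → ℝ) : ℝ :=
  (1 / 2) * ∑ x ∈ VN L A n, ∑ y ∈ VN L A n,
    (if Adj L A n x y then (f x - f y) ^ 2 else 0)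

/-- The effective resistance between `S` and `T` in the level-`n` graph. -/
noncomputable def EffRes (L : ℕ) (A : Finset (ℕ × ℕ)) (n : ℕ) (S T : Set (ℝ × ℝ)) : ℝ :=
  (sInf {e : ℝ | ∃ f : ℝ × ℝ → ℝ,
      (∀ x ∈ S, f x = 1) ∧ (∀ x ∈ T, f x = 0) ∧ e = Dform L A n f})⁻¹

/-- `𝓡_n`, the resistance between the corners `(0,0)` and `(1,0)`. -/
noncomputable def RR (L : ℕ) (A : Finset (ℕ × ℕ)) (n : ℕ) : ℝ :=
  EffRes L A n {((0 : ℝ), (0 : ℝ))} {((1 : ℝ), (0 : ℝ))}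

/-- `𝓡̄_n`, the resistance between the left and right sides of the unit square. -/
noncomputable def RRbar (L : ℕ) (A : Finset (ℕ × ℕ)) (n : ℕ) : ℝ :=
  EffRes L A n
    ((VN L A n : Set (ℝ × ℝ)) ∩ ({(0 : ℝ)} ×ˢ Set.Icc (0 : ℝ) 1))
    ((VN L A n : Set (ℝ × ℝ)) ∩ ({(1 : ℝ)} ×ˢ Set.Icc (0 : ℝ) 1))

/-- The standing assumptions on `(L, A)` defining a generalized Sierpiński carpet. -/
structure GoodCarpet (L : ℕ) (A : Finset (ℕ × ℕ)) : Prop where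
  three_le : 3 ≤ L
  mem_lt : ∀ p ∈ A, p.1 < L ∧ p.2 < L
  symm_swap : ∀ a b : ℕ, (a, b) ∈ A → (b, a) ∈ A
  symm_reflect : ∀ a b : ℕ, (a, b) ∈ A → (L - 1 - a, b) ∈ A
  connected : IsConnected
    (⋃ p ∈ A, Set.Icc (((p.1 : ℝ) / L, (p.2 : ℝ) / L) : ℝ × ℝ)
      ((((p.1 : ℝ) + 1) / L, ((p.2 : ℝ) + 1) / L) : ℝ × ℝ))
  flat_border : ∀ a b : ℕ, a < L → b < L →
    (a = 0 ∨ a = L - 1 ∨ b = 0 ∨ b = L - 1) → (a, b) ∈ A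
  proper : ∃ a b : ℕ, a < L ∧ b < L ∧ (a, b) ∉ A

/-- The generalized Sierpiński carpet `F`. -/
def carpetF (L : ℕ) (A : Finset (ℕ × ℕ)) : Set (ℝ × ℝ) :=
  ⋂ n : ℕ, ⋃ w : Word A n, PsiW L w '' Set.Icc (((0 : ℝ), (0 : ℝ)) : ℝ × ℝ) ((1 : ℝ), (1 : ℝ))


/-! ### Self-similar energy and edges -/

/-- Energy of the four sides of the unit square. -/
noncomputable def qf (f : ℝ × ℝ → ℝ) : ℝ :=
  (f (0, 0) - f (1, 0)) ^ 2 + (f (1, 0) - f (1, 1)) ^ 2 +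
    (f (1, 1) - f (0, 1)) ^ 2 + (f (0, 1) - f (0, 0)) ^ 2

/-- Self-similar (cell-wise) energy. -/
noncomputable def En (L : ℕ) (A : Finset (ℕ × ℕ)) : ℕ → (ℝ × ℝ → ℝ) → ℝ
  | 0, f => qf f
  | n + 1, f => ∑ a ∈ A, En L A n (fun x => f (Psi L a x))

/-- Recursive description of the adjacency. -/
def Edge (L : ℕ) (A : Finset (ℕ × ℕ)) : ℕ → ℝ × ℝ → ℝ × ℝ → Prop
  | 0, x, y => x ∈ V0 ∧ y ∈ V0 ∧ (x.1 - y.1) ^ 2 + (x.2 - y.2) ^ 2 = 1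
  | n + 1, x, y => ∃ a ∈ A, ∃ x' y', Edge L A n x' y' ∧ x = Psi L a x' ∧ y = Psi L a y'

lemma mem_V0 (x : ℝ × ℝ) : x ∈ V0 ↔ x = (0, 0) ∨ x = (1, 0) ∨ x = (1, 1) ∨ x = (0, 1) := by
  simp [V0]

/-- Reflection in the line `x = 1/2`. -/
def Hr (x : ℝ × ℝ) : ℝ × ℝ := (1 - x.1, x.2)

lemma Hr_Hr (x : ℝ × ℝ) : Hr (Hr x) = x := by simp [Hr]

lemma Psi_swap (L : ℕ) (a : ℕ × ℕ) (x : ℝ × ℝ) :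
    (Psi L a x).swap = Psi L a.swap x.swap := rfl

lemma Psi_Hr {L : ℕ} (hL : 3 ≤ L) (a : ℕ × ℕ) (ha : a.1 < L) (x : ℝ × ℝ) :
    Hr (Psi L a x) = Psi L (L - 1 - a.1, a.2) (Hr x) := by
  have h1 : ((L - 1 - a.1 : ℕ) : ℝ) = L - 1 - a.1 := by
    rw [Nat.sub_sub, Nat.cast_sub (by omega)]; push_cast; ring
  have : (L : ℝ) ≠ 0 := by positivity
  simp only [Hr, Psi, h1]
  ext
  · simp; field_simp; ring
  · simp

variable {L : ℕ} {A : Finset (ℕ × ℕ)}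

lemma Edge_symm {k : ℕ} : ∀ {x y : ℝ × ℝ}, Edge L A k x y → Edge L A k y x := by
  induction k with
  | zero => rintro x y ⟨h1, h2, h3⟩; exact ⟨h2, h1, by rw [← h3]; ring⟩
  | succ k ih =>
    rintro x y ⟨a, ha, x', y', h, rfl, rfl⟩
    exact ⟨a, ha, y', x', ih h, rfl, rfl⟩

lemma Edge_swap (h : GoodCarpet L A) {k : ℕ} :
    ∀ {x y : ℝ × ℝ}, Edge L A k x y → Edge L A k x.swap y.swap := by
  induction k with
  | zero =>
    rintro x y ⟨h1, h2, h3⟩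
    refine ⟨?_, ?_, by simp; linarith⟩
    · rw [mem_V0] at *; rcases h1 with rfl | rfl | rfl | rfl <;> simp
    · rw [mem_V0] at *; rcases h2 with rfl | rfl | rfl | rfl <;> simp
  | succ k ih =>
    rintro x y ⟨a, ha, x', y', h', rfl, rfl⟩
    exact ⟨a.swap, h.symm_swap _ _ ha, _, _, ih h', rfl, rfl⟩

lemma Edge_Hr (h : GoodCarpet L A) {k : ℕ} :
    ∀ {x y : ℝ × ℝ}, Edge L A k x y → Edge L A k (Hr x) (Hr y) := by
  induction k with
  | zero =>
    rintro x y ⟨h1, h2, h3⟩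
    refine ⟨?_, ?_, by simp [Hr]; linarith⟩
    · rw [mem_V0] at *; rcases h1 with rfl | rfl | rfl | rfl <;> simp [Hr]
    · rw [mem_V0] at *; rcases h2 with rfl | rfl | rfl | rfl <;> simp [Hr]
  | succ k ih =>
    rintro x y ⟨a, ha, x', y', h', rfl, rfl⟩
    exact ⟨(L - 1 - a.1, a.2), h.symm_reflect _ _ ha, _, _, ih h',
      Psi_Hr h.three_le a (h.mem_lt a ha).1 _, Psi_Hr h.three_le a (h.mem_lt a ha).1 _⟩

/-- Integer coordinates of the endpoints of an edge. -/
lemma Edge_int (h : GoodCarpet L A) {k : ℕ} :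
    ∀ {x y : ℝ × ℝ}, Edge L A k x y → ∃ p q : ℤ × ℤ,
      (L : ℝ) ^ k * x.1 = p.1 ∧ (L : ℝ) ^ k * x.2 = p.2 ∧
      (L : ℝ) ^ k * y.1 = q.1 ∧ (L : ℝ) ^ k * y.2 = q.2 ∧
      (p.1 - q.1) ^ 2 + (p.2 - q.2) ^ 2 = 1 := by
  have hL := h.three_le
  have hL0 : (L : ℝ) ≠ 0 := by positivity
  induction k with
  | zero =>
    rintro x y ⟨h1, h2, h3⟩
    have key : ∀ z ∈ V0, ∃ p : ℤ × ℤ, z.1 = p.1 ∧ z.2 = p.2 := by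
      intro z hz
      rw [mem_V0] at hz
      rcases hz with rfl | rfl | rfl | rfl
      · exact ⟨(0, 0), by simp⟩
      · exact ⟨(1, 0), by simp⟩
      · exact ⟨(1, 1), by simp⟩
      · exact ⟨(0, 1), by simp⟩
    obtain ⟨p, hp1, hp2⟩ := key x h1
    obtain ⟨q, hq1, hq2⟩ := key y h2
    refine ⟨p, q, by simp [hp1], by simp [hp2], by simp [hq1], by simp [hq2], ?_⟩
    rw [hp1, hp2, hq1, hq2] at h3
    exact_mod_cast h3
  | succ k ih =>
    rintro x y ⟨a, ha, x', y', h', rfl, rfl⟩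
    obtain ⟨p, q, e1, e2, e3, e4, e5⟩ := ih h'
    refine ⟨(p.1 + L ^ k * a.1, p.2 + L ^ k * a.2), (q.1 + L ^ k * a.1, q.2 + L ^ k * a.2),
      ?_, ?_, ?_, ?_, ?_⟩
    · push_cast; rw [← e1]; simp only [Psi, pow_succ]; field_simp
    · push_cast; rw [← e2]; simp only [Psi, pow_succ]; field_simp
    · push_cast; rw [← e3]; simp only [Psi, pow_succ]; field_simp
    · push_cast; rw [← e4]; simp only [Psi, pow_succ]; field_simp
    · simpa using e5

lemma Edge_box (h : GoodCarpet L A) {k : ℕ} :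
    ∀ {x y : ℝ × ℝ}, Edge L A k x y → (0 ≤ x.1 ∧ x.1 ≤ 1) ∧ (0 ≤ x.2 ∧ x.2 ≤ 1) := by
  have hL := h.three_le
  have hL0 : (0 : ℝ) < L := by positivity
  induction k with
  | zero =>
    rintro x y ⟨h1, h2, h3⟩
    rw [mem_V0] at h1; rcases h1 with rfl | rfl | rfl | rfl <;> simp
  | succ k ih =>
    rintro x y ⟨a, ha, x', y', h', rfl, rfl⟩
    obtain ⟨⟨b1, b2⟩, b3, b4⟩ := ih h'
    obtain ⟨c1, c2⟩ := h.mem_lt a ha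
    have d1 : (a.1 : ℝ) + 1 ≤ L := by exact_mod_cast c1
    have d2 : (a.2 : ℝ) + 1 ≤ L := by exact_mod_cast c2
    refine ⟨⟨?_, ?_⟩, ?_, ?_⟩ <;> simp only [Psi]
    · positivity
    · rw [div_le_one hL0]; linarith
    · positivity
    · rw [div_le_one hL0]; linarith

lemma En_nonneg (k : ℕ) : ∀ f : ℝ × ℝ → ℝ, 0 ≤ En L A k f := by
  induction k with
  | zero => intro f; simp only [En, qf]; positivity
  | succ k ih => intro f; exact Finset.sum_nonneg fun a _ => ih _

lemma En_swap (h : GoodCarpet L A) (k : ℕ) :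
    ∀ f : ℝ × ℝ → ℝ, En L A k (fun x => f x.swap) = En L A k f := by
  induction k with
  | zero => intro f; simp only [En, qf, Prod.swap]; ring
  | succ k ih =>
    intro f
    simp only [En]
    refine Finset.sum_bij' (fun a _ => a.swap) (fun a _ => a.swap) ?_ ?_ ?_ ?_ ?_
    · intro a ha; exact h.symm_swap _ _ ha
    · intro a ha; exact h.symm_swap _ _ ha
    · simp
    · simp
    · intro a ha
      rw [← ih]; rfl

lemma En_Hr (h : GoodCarpet L A) (k : ℕ) :
    ∀ f : ℝ × ℝ → ℝ, En L A k (fun x => f (Hr x)) = En L A k f := by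
  induction k with
  | zero => intro f; simp only [En, qf, Hr]; norm_num; ring
  | succ k ih =>
    intro f
    simp only [En]
    have hb : ∀ a ∈ A, L - 1 - (L - 1 - a.1) = a.1 := by
      intro a ha; have := (h.mem_lt a ha).1; omega
    refine Finset.sum_bij' (fun a _ => (L - 1 - a.1, a.2)) (fun a _ => (L - 1 - a.1, a.2))
      ?_ ?_ ?_ ?_ ?_
    · intro a ha; exact h.symm_reflect _ _ ha
    · intro a ha; exact h.symm_reflect _ _ ha
    · intro a ha; simp [hb a ha]
    · intro a ha; simp [hb a ha]
    · intro a ha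
      rw [← ih (fun x => f (Psi L (L - 1 - a.1, a.2) x))]
      simp only [Psi_Hr h.three_le a (h.mem_lt a ha).1]

/-- Comparison of energies from comparison on edges. -/
lemma En_mono {ι : Type} [Fintype ι] (k : ℕ) (c : ℝ) : ∀ (u : ℝ × ℝ → ℝ) (F : ι → ℝ × ℝ → ℝ),
    (∀ x y, Edge L A k x y → (u x - u y) ^ 2 ≤ c * ∑ i, (F i x - F i y) ^ 2) →
    En L A k u ≤ c * ∑ i, En L A k (F i) := by
  induction k with
  | zero =>
    intro u F hu
    have e1 := hu (0, 0) (1, 0) ⟨by simp [mem_V0], by simp [mem_V0], by norm_num⟩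
    have e2 := hu (1, 0) (1, 1) ⟨by simp [mem_V0], by simp [mem_V0], by norm_num⟩
    have e3 := hu (1, 1) (0, 1) ⟨by simp [mem_V0], by simp [mem_V0], by norm_num⟩
    have e4 := hu (0, 1) (0, 0) ⟨by simp [mem_V0], by simp [mem_V0], by norm_num⟩
    simp only [En, qf, Finset.sum_add_distrib]
    linarith
  | succ k ih =>
    intro u F hu
    simp only [En]
    rw [Finset.sum_comm, Finset.mul_sum]
    refine Finset.sum_le_sum fun a ha => ?_
    refine ih (fun x => u (Psi L a x)) (fun i x => F i (Psi L a x)) ?_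
    intro x y hxy
    exact hu _ _ ⟨a, ha, x, y, hxy, rfl, rfl⟩

lemma En_mono_one (k : ℕ) (c : ℝ) (u F : ℝ × ℝ → ℝ)
    (hu : ∀ x y, Edge L A k x y → (u x - u y) ^ 2 ≤ c * (F x - F y) ^ 2) :
    En L A k u ≤ c * En L A k F := by
  have := En_mono (L := L) (A := A) (ι := Unit) k c u (fun _ => F) (by simpa using hu)
  simpa using this

lemma En_mono_two (k : ℕ) (c : ℝ) (u F G : ℝ × ℝ → ℝ)
    (hu : ∀ x y, Edge L A k x y → (u x - u y) ^ 2 ≤ c * ((F x - F y) ^ 2 + (G x - G y) ^ 2)) :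
    En L A k u ≤ c * (En L A k F + En L A k G) := by
  have := En_mono (L := L) (A := A) (ι := Bool) k c u (fun b => if b then F else G)
    (by simpa using hu)
  simpa using this

/-- Crude lower bound on the energy: corner to corner along the bottom side. -/
lemma En_corner_crude (h : GoodCarpet L A) (k : ℕ) : ∀ f : ℝ × ℝ → ℝ,
    (f (0, 0) - f (1, 0)) ^ 2 ≤ (L : ℝ) ^ k * En L A k f := by
  have hL := h.three_le
  have hL0 : (L : ℝ) ≠ 0 := by positivity
  induction k with
  | zero =>
    intro f
    simp only [En, qf, pow_zero, one_mul]
    nlinarith [sq_nonneg (f (1, 0) - f (1, 1)), sq_nonneg (f (1, 1) - f (0, 1)),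
      sq_nonneg (f (0, 1) - f (0, 0))]
  | succ k ih =>
    intro f
    have e1 : f (0, 0) - f (1, 0) = ∑ i ∈ Finset.range L,
        (f (Psi L (i, 0) (0, 0)) - f (Psi L (i, 0) (1, 0))) := by
      have := Finset.sum_range_sub' (fun i : ℕ => f ((i : ℝ) / L, 0)) L
      simp only [Nat.cast_zero, zero_div, div_self hL0] at this
      rw [← this]
      refine Finset.sum_congr rfl fun i _ => ?_
      simp [Psi, add_comm]
    have e2 : ∀ i ∈ Finset.range L, (i, 0) ∈ A := by
      intro i hi
      exact h.flat_border i 0 (Finset.mem_range.1 hi) (by omega) (by simp)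
    rw [e1]
    calc (∑ i ∈ Finset.range L, (f (Psi L (i, 0) (0, 0)) - f (Psi L (i, 0) (1, 0)))) ^ 2
        ≤ (L : ℝ) * ∑ i ∈ Finset.range L,
          (f (Psi L (i, 0) (0, 0)) - f (Psi L (i, 0) (1, 0))) ^ 2 := by
          have := sq_sum_le_card_mul_sum_sq (s := Finset.range L)
            (f := fun i => f (Psi L (i, 0) (0, 0)) - f (Psi L (i, 0) (1, 0)))
          simpa using this
      _ ≤ (L : ℝ) * ∑ i ∈ Finset.range L,
          (L : ℝ) ^ k * En L A k (fun x => f (Psi L (i, 0) x)) := by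
          gcongr with i hi
          exact ih (fun x => f (Psi L (i, 0) x))
      _ = (L : ℝ) ^ (k + 1) * ∑ a ∈ (Finset.range L).image (fun i => ((i, 0) : ℕ × ℕ)),
            En L A k (fun x => f (Psi L a x)) := by
          rw [Finset.sum_image (by intro a _ b _ hab; simpa using hab), ← Finset.mul_sum]; ring
      _ ≤ (L : ℝ) ^ (k + 1) * En L A (k + 1) f := by
          simp only [En]
          refine mul_le_mul_of_nonneg_left ?_ (by positivity)
          refine Finset.sum_le_sum_of_subset_of_nonneg ?_ fun a _ _ => En_nonneg _ _
          intro a ha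
          obtain ⟨i, hi, rfl⟩ := Finset.mem_image.1 ha
          exact e2 i hi

/-- The linear function has exponentially small energy. -/
lemma En_linear (h : GoodCarpet L A) (k : ℕ) : ∀ c d : ℝ,
    En L A k (fun x => c * x.1 + d) = 2 * c ^ 2 * ((A.card : ℝ) / L ^ 2) ^ k := by
  have hL := h.three_le
  have hL0 : (L : ℝ) ≠ 0 := by positivity
  induction k with
  | zero => intro c d; simp only [En, qf]; ring
  | succ k ih =>
    intro c d
    simp only [En]
    have : ∀ a ∈ A, En L A k (fun x => c * (Psi L a x).1 + d) =
        2 * (c / L) ^ 2 * ((A.card : ℝ) / L ^ 2) ^ k := by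
      intro a _
      rw [← ih (c / L) (c * a.1 / L + d)]
      congr 1; funext x; simp only [Psi]; field_simp; ring
    rw [Finset.sum_congr rfl this, Finset.sum_const, nsmul_eq_mul, pow_succ]
    ring

/-! ### Planarity: left-right and bottom-top lattice paths meet -/

lemma int_step {p q : ℤ × ℤ} (h : (p.1 - q.1) ^ 2 + (p.2 - q.2) ^ 2 = 1) :
    (q.1 = p.1 + 1 ∧ q.2 = p.2) ∨ (p.1 = q.1 + 1 ∧ q.2 = p.2) ∨
    (q.1 = p.1 ∧ q.2 = p.2 + 1) ∨ (q.1 = p.1 ∧ p.2 = q.2 + 1) := by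
  have h1 : -1 ≤ p.1 - q.1 ∧ p.1 - q.1 ≤ 1 := by constructor <;> nlinarith
  have h2 : -1 ≤ p.2 - q.2 ∧ p.2 - q.2 ≤ 1 := by constructor <;> nlinarith
  obtain ⟨a1, a2⟩ := h1
  obtain ⟨b1, b2⟩ := h2
  generalize hu : p.1 - q.1 = u at *
  generalize hv : p.2 - q.2 = v at *
  interval_cases u <;> interval_cases v <;> simp_all <;> omega

/-- Lattice steps staying in `S`. -/
def ZStep (S : Set (ℤ × ℤ)) (p q : ℤ × ℤ) : Prop :=
  p ∈ S ∧ q ∈ S ∧ (p.1 - q.1) ^ 2 + (p.2 - q.2) ^ 2 = 1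

lemma flux_exists (N : ℤ) (S : Set (ℤ × ℤ)) (hS : ∀ p ∈ S, 0 ≤ p.2 ∧ p.2 ≤ N)
    (l : ℤ × ℤ) (p : ℤ × ℤ) (hp : Relation.ReflTransGen (ZStep S) l p) :
    ∃ c : ℤ → ℤ → ℤ, (∀ x y, y ≤ 0 → c x y = 0) ∧
      (∀ x y, (x, y) ∉ S → c x (y + 1) = c x y) ∧
      (∀ x y, (x + 1, y) ∉ S → (if p.1 = x + 1 ∧ p.2 < y then (1 : ℤ) else 0) -
        (if l.1 = x + 1 ∧ l.2 < y then (1 : ℤ) else 0) = c x y - c (x + 1) y) ∧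
      (∀ x, (x, N) ∉ S → c x N = (if x < p.1 then (1 : ℤ) else 0) -
        (if x < l.1 then (1 : ℤ) else 0)) := by
  induction hp with
  | refl => exact ⟨fun _ _ => 0, by simp, by simp, by simp, by simp⟩
  | @tail p q _ hpq ih =>
    obtain ⟨c, c0, c1, c2, c3⟩ := ih
    obtain ⟨hp, hq, hst⟩ := hpq
    have hbp := hS p hp
    have hbq := hS q hq
    have hne : ∀ {z : ℤ × ℤ}, z ∉ S → ¬ (z.1 = p.1 ∧ z.2 = p.2) ∧ ¬ (z.1 = q.1 ∧ z.2 = q.2) := by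
      intro z hz
      constructor
      · rintro ⟨e1, e2⟩; exact hz (by rw [show z = p from Prod.ext e1 e2]; exact hp)
      · rintro ⟨e1, e2⟩; exact hz (by rw [show z = q from Prod.ext e1 e2]; exact hq)
    refine ⟨fun x y => c x y + (if q.1 = p.1 + 1 ∧ x = p.1 ∧ p.2 < y then 1 else 0) -
      (if p.1 = q.1 + 1 ∧ x = q.1 ∧ p.2 < y then 1 else 0), ?_, ?_, ?_, ?_⟩
    · intro x y hy
      have := c0 x y hy
      simp only [this]
      split_ifs <;> omega
    · intro x y hxy
      have h1 := c1 x y hxy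
      have h2 := hne hxy
      simp only [h1]
      rcases int_step hst with h | h | h | h <;> split_ifs <;> simp at h2 <;> omega
    · intro x y hxy
      have h1 := c2 x y hxy
      have h2 := hne hxy
      simp only at h2 ⊢
      rcases int_step hst with h | h | h | h <;> split_ifs at h1 ⊢ <;> omega
    · intro x hx
      have h1 := c3 x hx
      have h2 := hne hx
      simp only at h2 ⊢
      rcases int_step hst with h | h | h | h <;> split_ifs at h1 ⊢ <;> omega

lemma planar_int (N : ℤ) (hN : 1 ≤ N) (S T : Set (ℤ × ℤ))
    (hS : ∀ p ∈ S, (0 ≤ p.1 ∧ p.1 ≤ N) ∧ 0 ≤ p.2 ∧ p.2 ≤ N)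
    (hT : ∀ p ∈ T, (0 ≤ p.1 ∧ p.1 ≤ N) ∧ 0 ≤ p.2 ∧ p.2 ≤ N)
    (l r b t : ℤ × ℤ) (hlr : Relation.ReflTransGen (ZStep S) l r)
    (hbt : Relation.ReflTransGen (ZStep T) b t)
    (hl : l.1 = 0) (hr : r.1 = N) (hb : b.2 = 0) (ht : t.2 = N) :
    ∃ p, p ∈ S ∧ p ∈ T := by
  by_contra hcon
  push Not at hcon
  have hrS : r ∈ S := by
    rcases hlr.cases_tail with e | ⟨s, _, hs⟩
    · exfalso; rw [e] at hr; omega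
    · exact hs.2.1
  have htT : t ∈ T := by
    rcases hbt.cases_tail with e | ⟨s, _, hs⟩
    · exfalso; rw [e] at ht; omega
    · exact hs.2.1
  set S' : Set (ℤ × ℤ) := insert (N + 1, r.2) S with hS'
  have hpath : Relation.ReflTransGen (ZStep S') l (N + 1, r.2) := by
    refine Relation.ReflTransGen.tail (Relation.ReflTransGen.mono ?_ _ _ hlr) (b := r) ?_
    · rintro p q ⟨h1, h2, h3⟩
      exact ⟨Set.mem_insert_of_mem _ h1, Set.mem_insert_of_mem _ h2, h3⟩
    · exact ⟨Set.mem_insert_of_mem _ hrS, Set.mem_insert _ _, by rw [hr]; ring⟩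
  have hTS : ∀ p ∈ T, p ∉ S' := by
    intro p hp hp'
    rcases hp' with e | e
    · have := (hT p hp).1.2; rw [e] at this; simp at this
    · exact hcon p e hp
  obtain ⟨c, c0, c1, c2, c3⟩ := flux_exists N S' (by
    rintro p (rfl | hp)
    · exact (hS r hrS).2
    · exact (hS p hp).2) l _ hpath
  have inv : ∀ s, Relation.ReflTransGen (ZStep T) b s → c s.1 s.2 = 0 := by
    intro s hs
    induction hs with
    | refl => exact c0 _ _ (by omega)
    | @tail p q _ hpq ih =>
      obtain ⟨hp, hq, hst⟩ := hpq
      have bp := hT p hp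
      have bq := hT q hq
      have np := hTS p hp
      have nq := hTS q hq
      rcases int_step hst with ⟨h1, h2⟩ | ⟨h1, h2⟩ | ⟨h1, h2⟩ | ⟨h1, h2⟩
      · have := c2 p.1 p.2 (by rw [← h1, ← h2]; exact nq)
        rw [if_neg (by simp; omega), if_neg (by omega)] at this
        rw [h1, h2]; omega
      · have := c2 q.1 q.2 (by rw [← h1, h2]; exact np)
        rw [if_neg (by simp; omega), if_neg (by omega), ← h1, h2] at this
        rw [h2]; omega
      · have := c1 p.1 p.2 np
        rw [h1, h2, this, ih]
      · have := c1 q.1 q.2 nq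
        rw [← this, ← h2, h1, ih]
  have h1 := inv t hbt
  have h2 := c3 t.1 (by rw [← ht]; exact hTS t htT)
  have h3 := hT t htT
  rw [ht, h2, if_pos (by simp; omega), if_neg (by omega)] at h1
  omega

/-- Paths of the level `k` graph inside `Z`. -/
def Pth (L : ℕ) (A : Finset (ℕ × ℕ)) (k : ℕ) (Z : Set (ℝ × ℝ)) : ℝ × ℝ → ℝ × ℝ → Prop :=
  Relation.ReflTransGen (fun x y => Edge L A k x y ∧ x ∈ Z ∧ y ∈ Z)

lemma planar (h : GoodCarpet L A) (k : ℕ) (Z1 Z2 : Set (ℝ × ℝ)) (l r b t : ℝ × ℝ)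
    (hlr : Pth L A k Z1 l r) (hbt : Pth L A k Z2 b t)
    (hl : l.1 = 0) (hr : r.1 = 1) (hb : b.2 = 0) (ht : t.2 = 1) : ∃ x, x ∈ Z1 ∧ x ∈ Z2 := by
  have hL := h.three_le
  have hLk : (0 : ℝ) < (L : ℝ) ^ k := by positivity
  set M : ℝ := (L : ℝ) ^ k with hM
  let φ : ℝ × ℝ → ℤ × ℤ := fun x => (⌊M * x.1⌋, ⌊M * x.2⌋)
  let ψ : ℤ × ℤ → ℝ × ℝ := fun p => (p.1 / M, p.2 / M)
  let N : ℤ := (L : ℤ) ^ k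
  have hNM : (N : ℝ) = M := by simp [N, hM]
  let B : Set (ℝ × ℝ) → Set (ℤ × ℤ) := fun Z =>
    {p | ψ p ∈ Z ∧ (0 ≤ p.1 ∧ p.1 ≤ N) ∧ 0 ≤ p.2 ∧ p.2 ≤ N}
  have hmem : ∀ Z x y, Edge L A k x y → x ∈ Z → φ x ∈ B Z := by
    intro Z x y hxy hx
    obtain ⟨p, q, e1, e2, -, -, -⟩ := Edge_int h hxy
    have hp : φ x = p := by simp [φ, hM, e1, e2]
    have hψ : ψ p = x := by
      simp only [ψ, ← e1, ← e2, hM]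
      ext <;> simp <;> field_simp
    obtain ⟨⟨b1, b2⟩, b3, b4⟩ := Edge_box h hxy
    rw [hp]
    refine ⟨by rw [hψ]; exact hx, ⟨?_, ?_⟩, ?_, ?_⟩
    · have : (0 : ℝ) ≤ p.1 := by rw [← e1]; positivity
      exact_mod_cast this
    · have : (p.1 : ℝ) ≤ N := by rw [← e1, hNM, ← hM]; nlinarith
      exact_mod_cast this
    · have : (0 : ℝ) ≤ p.2 := by rw [← e2]; positivity
      exact_mod_cast this
    · have : (p.2 : ℝ) ≤ N := by rw [← e2, hNM, ← hM]; nlinarith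
      exact_mod_cast this
  have lift : ∀ Z x y, Pth L A k Z x y → Relation.ReflTransGen (ZStep (B Z)) (φ x) (φ y) := by
    intro Z x y hxy
    refine Relation.ReflTransGen.lift φ ?_ _ _ hxy
    rintro u v ⟨he, hu, hv⟩
    refine ⟨hmem Z u v he hu, hmem Z v u (Edge_symm he) hv, ?_⟩
    obtain ⟨p, q, e1, e2, e3, e4, e5⟩ := Edge_int h he
    simpa [φ, hM, e1, e2, e3, e4] using e5
  have hfl : ⌊M⌋ = N := by rw [← hNM]; simp
  obtain ⟨p, hp1, hp2⟩ := planar_int N (one_le_pow₀ (by omega)) (B Z1) (B Z2)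
    (fun p hp => hp.2) (fun p hp => hp.2) _ _ _ _ (lift _ _ _ hlr) (lift _ _ _ hbt)
    (by simp [φ, hl]) (by simp [φ, hr, hfl]) (by simp [φ, hb]) (by simp [φ, ht, hfl])
  exact ⟨ψ p, hp1.1, hp2.1⟩

/-! ### Short crossings -/

lemma Pth_map {k k' : ℕ} {Z Z' : Set (ℝ × ℝ)} (g : ℝ × ℝ → ℝ × ℝ)
    (hg : ∀ x y, Edge L A k x y → Edge L A k' (g x) (g y)) (hZ : ∀ z ∈ Z, g z ∈ Z')
    {x y : ℝ × ℝ} (hp : Pth L A k Z x y) : Pth L A k' Z' (g x) (g y) := by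
  refine Relation.ReflTransGen.lift g ?_ _ _ hp
  rintro u v ⟨he, hu, hv⟩
  exact ⟨hg _ _ he, hZ _ hu, hZ _ hv⟩

lemma Pth_mono {k : ℕ} {Z Z' : Set (ℝ × ℝ)} (hZ : ∀ z ∈ Z, z ∈ Z')
    {x y : ℝ × ℝ} (hp : Pth L A k Z x y) : Pth L A k Z' x y :=
  Pth_map id (fun _ _ h => h) hZ hp

lemma Pth_symm {k : ℕ} {Z : Set (ℝ × ℝ)} {x y : ℝ × ℝ} (hp : Pth L A k Z x y) :
    Pth L A k Z y x := by
  induction hp with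
  | refl => exact Relation.ReflTransGen.refl
  | tail _ he ih => exact Relation.ReflTransGen.head ⟨Edge_symm he.1, he.2.2, he.2.1⟩ ih

/-- `f` is `1` on the left line and `0` on the right line. -/
def IsLR (f : ℝ × ℝ → ℝ) : Prop := (∀ y, f (0, y) = 1) ∧ ∀ y, f (1, y) = 0

/-- Left-right conductance. -/
noncomputable def ek (L : ℕ) (A : Finset (ℕ × ℕ)) (k : ℕ) : ℝ :=
  sInf {e : ℝ | ∃ f, IsLR f ∧ e = En L A k f}

lemma linear_LR : IsLR (fun x => (-1) * x.1 + 1) := by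
  constructor <;> intro y <;> simp

lemma ek_le {k : ℕ} {f : ℝ × ℝ → ℝ} (hf : IsLR f) : ek L A k ≤ En L A k f := by
  refine csInf_le ⟨0, ?_⟩ ⟨f, hf, rfl⟩
  rintro e ⟨f, -, rfl⟩
  exact En_nonneg _ _

lemma ek_pos (h : GoodCarpet L A) (k : ℕ) : 0 < ek L A k := by
  have hL := h.three_le
  have hL0 : (0 : ℝ) < L := by positivity
  have : ((L : ℝ) ^ k)⁻¹ ≤ ek L A k := by
    refine le_csInf ⟨_, _, linear_LR, rfl⟩ ?_
    rintro e ⟨f, hf, rfl⟩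
    have := En_corner_crude h k f
    rw [hf.1, hf.2] at this
    rw [inv_le_iff_one_le_mul₀ (by positivity)]
    linarith
  exact lt_of_lt_of_le (by positivity) this

lemma ek_near (h : GoodCarpet L A) (k : ℕ) : ∃ f, IsLR f ∧ En L A k f ≤ 2 * ek L A k := by
  have h0 := ek_pos h k
  obtain ⟨e, ⟨f, hf, rfl⟩, he⟩ := exists_lt_of_csInf_lt
    (s := {e : ℝ | ∃ f, IsLR f ∧ e = En L A k f}) ⟨_, _, linear_LR, rfl⟩
    (show ek L A k < 2 * ek L A k by linarith)
  exact ⟨f, hf, he.le⟩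

/-- Points reachable from the left side, together with the length of the path. -/
inductive Rch (L : ℕ) (A : Finset (ℕ × ℕ)) (k : ℕ) {ι : Type} [Fintype ι]
    (F : ι → ℝ × ℝ → ℝ) (l : ℝ × ℝ) : ℝ × ℝ → ℝ → Prop
  | start : l.1 = 0 → Rch L A k F l l 0
  | step {x y : ℝ × ℝ} {s : ℝ} : Rch L A k F l x s → Edge L A k x y →
      Rch L A k F l y (s + ∑ i, |F i x - F i y|)

lemma Rch_path {k : ℕ} {ι : Type} [Fintype ι] {F : ι → ℝ × ℝ → ℝ} {l x : ℝ × ℝ} {s : ℝ}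
    (hr : Rch L A k F l x s) : l.1 = 0 ∧ 0 ≤ s ∧ (∀ i, |F i x - F i l| ≤ s) ∧
      Pth L A k {z | ∀ i, |F i z - F i l| ≤ s} l x := by
  induction hr with
  | start h => exact ⟨h, le_rfl, by simp, Relation.ReflTransGen.refl⟩
  | @step x y s _ he ih =>
    obtain ⟨h0, h1, h2, h3⟩ := ih
    have hs : 0 ≤ ∑ i, |F i x - F i y| := Finset.sum_nonneg fun i _ => abs_nonneg _
    have h4 : ∀ i, |F i y - F i l| ≤ s + ∑ i, |F i x - F i y| := by
      intro i
      have e1 := h2 i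
      have e2 : |F i x - F i y| ≤ ∑ i, |F i x - F i y| :=
        Finset.single_le_sum (f := fun i => |F i x - F i y|)
          (fun i _ => abs_nonneg _) (Finset.mem_univ i)
      have e3 := abs_sub_le (F i y) (F i x) (F i l)
      rw [abs_sub_comm (F i y) (F i x)] at e3
      linarith
    refine ⟨h0, by linarith, h4, ?_⟩
    refine Relation.ReflTransGen.tail (Pth_mono ?_ h3) ⟨he, ?_, h4⟩
    · intro z hz i; have := hz i; linarith
    · intro i; have := h2 i; linarith

lemma crossing (h : GoodCarpet L A) (k : ℕ) {ι : Type} [Fintype ι] (F : ι → ℝ × ℝ → ℝ)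
    (c : ℝ) (hc : 0 < c)
    (hlt : (Fintype.card ι : ℝ) * ∑ i, En L A k (F i) < c ^ 2 * ek L A k) :
    ∃ l r : ℝ × ℝ, l.1 = 0 ∧ r.1 = 1 ∧ Pth L A k {z | ∀ i, |F i z - F i l| ≤ c} l r := by
  by_contra hcon
  push Not at hcon
  let Sx : ℝ × ℝ → Set ℝ := fun x => insert c {s | ∃ l, Rch L A k F l x s}
  let u : ℝ × ℝ → ℝ := fun x => sInf (Sx x)
  have hbd : ∀ x, ∀ s ∈ Sx x, 0 ≤ s := by
    rintro x s (rfl | ⟨l, hl⟩)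
    · exact hc.le
    · exact (Rch_path hl).2.1
  have hbb : ∀ x, BddBelow (Sx x) := fun x => ⟨0, fun s hs => hbd x s hs⟩
  have hne : ∀ x, (Sx x).Nonempty := fun x => ⟨c, Set.mem_insert _ _⟩
  have hu0 : ∀ y, u (0, y) = 0 := by
    intro y
    refine le_antisymm (csInf_le (hbb _) (Set.mem_insert_of_mem _ ⟨(0, y), Rch.start rfl⟩)) ?_
    exact le_csInf (hne _) (hbd _)
  have hu1 : ∀ y, u (1, y) = c := by
    intro y
    refine le_antisymm (csInf_le (hbb _) (Set.mem_insert _ _)) (le_csInf (hne _) ?_)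
    rintro s (rfl | ⟨l, hl⟩)
    · exact le_rfl
    · by_contra hs
      push Not at hs
      obtain ⟨h0, h1, h2, h3⟩ := Rch_path hl
      exact hcon l (1, y) h0 rfl (Pth_mono (Z := {z | ∀ i, |F i z - F i l| ≤ s})
        (fun z hz i => (hz i).trans hs.le) h3)
  have hstep : ∀ x y, Edge L A k x y → u y ≤ u x + ∑ i, |F i x - F i y| := by
    intro x y he
    rw [← sub_le_iff_le_add]
    refine le_csInf (hne _) ?_
    rintro s (rfl | ⟨l, hl⟩)
    · have : u y ≤ s := csInf_le (hbb _) (Set.mem_insert _ _)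
      have hs : 0 ≤ ∑ i, |F i x - F i y| := Finset.sum_nonneg fun i _ => abs_nonneg _
      linarith
    · have : u y ≤ s + ∑ i, |F i x - F i y| :=
        csInf_le (hbb _) (Set.mem_insert_of_mem _ ⟨l, hl.step he⟩)
      linarith
  have hLR : IsLR (fun x => 1 - u x / c) := by
    constructor
    · intro y; simp [hu0]
    · intro y; simp [hu1, hc.ne']
  have hE : En L A k (fun x => 1 - u x / c) ≤
      ((Fintype.card ι : ℝ) / c ^ 2) * ∑ i, En L A k (F i) := by
    refine En_mono k _ _ F ?_
    intro x y he
    have e1 := hstep x y he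
    have e2 := hstep y x (Edge_symm he)
    have e3 : ∑ i, |F i y - F i x| = ∑ i, |F i x - F i y| :=
      Finset.sum_congr rfl fun i _ => abs_sub_comm _ _
    rw [e3] at e2
    have e4 : |u x - u y| ≤ ∑ i, |F i x - F i y| := by rw [abs_le]; constructor <;> linarith
    have e5 : (u x - u y) ^ 2 ≤ (∑ i, |F i x - F i y|) ^ 2 := by
      rw [← sq_abs (u x - u y)]
      exact pow_le_pow_left₀ (abs_nonneg _) e4 2
    have e6 : (∑ i, |F i x - F i y|) ^ 2 ≤ (Fintype.card ι : ℝ) * ∑ i, (F i x - F i y) ^ 2 := by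
      have := sq_sum_le_card_mul_sum_sq (s := (Finset.univ : Finset ι))
        (f := fun i => |F i x - F i y|)
      simpa using this
    have e7 : (1 - u x / c - (1 - u y / c)) ^ 2 = (u x - u y) ^ 2 / c ^ 2 := by
      field_simp; ring
    rw [e7, div_mul_eq_mul_div]
    gcongr
    linarith
  have h1 := ek_le (A := A) (L := L) (k := k) hLR
  rw [div_mul_eq_mul_div, le_div_iff₀ (by positivity)] at hE
  nlinarith [pow_pos hc 2]

/-- The identity or the reflection, according to parity. -/
def fold (i : ℕ) (x : ℝ × ℝ) : ℝ × ℝ := if Even i then x else Hr x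

lemma bottom_mem (h : GoodCarpet L A) {i : ℕ} (hi : i < L) : (i, 0) ∈ A :=
  h.flat_border i 0 hi (by omega) (by simp)

lemma Edge_bottom (h : GoodCarpet L A) {k i : ℕ} (hi : i < L) {x y : ℝ × ℝ}
    (he : Edge L A k x y) : Edge L A (k + 1) (Psi L (i, 0) x) (Psi L (i, 0) y) :=
  ⟨(i, 0), bottom_mem h hi, x, y, he, rfl, rfl⟩

lemma Edge_fold (h : GoodCarpet L A) {k i : ℕ} {x y : ℝ × ℝ}
    (he : Edge L A k x y) : Edge L A k (fold i x) (fold i y) := by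
  unfold fold; split_ifs
  · exact he
  · exact Edge_Hr h he

lemma bottom_sum (h : GoodCarpet L A) (k : ℕ) (f : ℝ × ℝ → ℝ) :
    ∑ i : Fin L, En L A k (fun x => f (Psi L ((i : ℕ), 0) (fold i x))) ≤ En L A (k + 1) f := by
  have e0 : ∀ i : Fin L, En L A k (fun x => f (Psi L ((i : ℕ), 0) (fold i x))) =
      En L A k (fun x => f (Psi L ((i : ℕ), 0) x)) := by
    intro i
    by_cases hi : Even (i : ℕ)
    · simp only [fold, if_pos hi]
    · simp only [fold, if_neg hi]
      exact En_Hr h k (fun x => f (Psi L ((i : ℕ), 0) x))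
  rw [Finset.sum_congr rfl fun i _ => e0 i,
    Fin.sum_univ_eq_sum_range (fun i => En L A k (fun x => f (Psi L (i, 0) x))) L]
  have e1 : ∑ i ∈ Finset.range L, En L A k (fun x => f (Psi L (i, 0) x)) =
      ∑ a ∈ (Finset.range L).image (fun i => ((i, 0) : ℕ × ℕ)),
        En L A k (fun x => f (Psi L a x)) := by
    rw [Finset.sum_image (by intro a _ b _ hab; simpa using hab)]
  rw [e1]
  simp only [En]
  refine Finset.sum_le_sum_of_subset_of_nonneg ?_ fun a _ _ => En_nonneg _ _
  intro a ha
  obtain ⟨i, hi, rfl⟩ := Finset.mem_image.1 ha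
  exact bottom_mem h (Finset.mem_range.1 hi)

lemma unfolding (h : GoodCarpet L A) (k : ℕ) (f : ℝ × ℝ → ℝ) (c : ℝ) (l r : ℝ × ℝ)
    (hl : l.1 = 0) (hr : r.1 = 1)
    (hp : Pth L A k {z | ∀ i : Fin L, |f (Psi L ((i : ℕ), 0) (fold i z)) -
      f (Psi L ((i : ℕ), 0) (fold i l))| ≤ c} l r) (n : ℕ) (hn : n < L) :
    |f (Psi L (n, 0) (fold n l)) - f (Psi L (0, 0) l)| ≤ 2 * n * c ∧
    Pth L A (k + 1) {z | |f z - f (Psi L (0, 0) l)| ≤ (2 * n + 1) * c} (Psi L (0, 0) l)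
      (Psi L (n, 0) (fold n (if Even n then r else l))) := by
  have hlr : l ≠ r := by intro e; rw [e, hr] at hl; norm_num at hl
  have hrZ : ∀ i : ℕ, i < L → |f (Psi L (i, 0) (fold i r)) - f (Psi L (i, 0) (fold i l))| ≤ c := by
    intro i hi
    rcases hp.cases_tail with e | ⟨s, _, hs⟩
    · exact absurd e.symm hlr
    · exact hs.2.2 ⟨i, hi⟩
  have hc : 0 ≤ c := (abs_nonneg _).trans (hrZ n hn)
  induction n with
  | zero =>
    refine ⟨by simp [fold], ?_⟩
    simp only [fold, Even.zero, if_true]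
    refine Pth_map (Psi L (0, 0)) (fun x y he => Edge_bottom h hn he) ?_ hp
    intro z hz
    have := hz ⟨0, hn⟩
    simpa [fold] using this
  | succ n ih =>
    obtain ⟨i1, i2⟩ := ih (by omega)
    have hL0 : (L : ℝ) ≠ 0 := by have := h.three_le; positivity
    have hpt : Psi L (n, 0) (fold n (if Even n then r else l)) =
        Psi L (n + 1, 0) (fold (n + 1) (if Even n then r else l)) := by
      by_cases hne : Even n
      · simp only [fold, hne, if_true, Nat.even_add_one, not_true, if_false]
        simp only [Psi, Hr, hr]; push_cast; ext <;> simp; ring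
      · simp only [fold, hne, if_false, Nat.even_add_one, not_false_iff, if_true]
        simp only [Psi, Hr, hl]; push_cast; ext <;> simp; ring
    have hd : |f (Psi L (n + 1, 0) (fold (n + 1) l)) - f (Psi L (0, 0) l)| ≤
        2 * ((n + 1 : ℕ) : ℝ) * c := by
      have a1 := hrZ n (by omega)
      have a2 := hrZ (n + 1) hn
      by_cases hne : Even n
      · simp only [hne, if_true] at hpt
        rw [hpt] at a1
        push_cast
        rw [abs_le] at *
        constructor <;> linarith [a1.1, a1.2, a2.1, a2.2, i1.1, i1.2]
      · simp only [hne, if_false] at hpt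
        rw [← hpt]
        push_cast
        nlinarith
    refine ⟨hd, ?_⟩
    have p1 : Pth L A (k + 1) {z | |f z - f (Psi L (0, 0) l)| ≤ (2 * ((n + 1 : ℕ) : ℝ) + 1) * c}
        (Psi L (n + 1, 0) (fold (n + 1) l)) (Psi L (n + 1, 0) (fold (n + 1) r)) := by
      refine Pth_map (fun x => Psi L (n + 1, 0) (fold (n + 1) x))
        (fun x y he => Edge_bottom h hn (Edge_fold h he)) ?_ hp
      intro z hz
      have b1 := hz ⟨n + 1, hn⟩
      simp only at b1
      have b2 := abs_sub_le (f (Psi L (n + 1, 0) (fold (n + 1) z)))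
        (f (Psi L (n + 1, 0) (fold (n + 1) l))) (f (Psi L (0, 0) l))
      simp only [Set.mem_ofPred_eq]
      linarith
    refine Relation.ReflTransGen.trans (Pth_mono ?_ i2) ?_
    · intro z hz
      simp only [Set.mem_ofPred_eq] at hz ⊢
      push_cast; linarith
    · rw [hpt]
      by_cases hne : Even n
      · simp only [hne, if_true, Nat.even_add_one, not_true, if_false]
        exact Pth_symm p1
      · simp only [hne, if_false, Nat.even_add_one, not_false_iff, if_true]
        exact p1

/-- Constant of the corner estimate. -/
noncomputable def Bk (L : ℕ) (A : Finset (ℕ × ℕ)) (k : ℕ) : ℝ :=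
  1 + ∑ j ∈ Finset.range k, (2 * (2 * Real.sqrt (1 / ek L A (j + 1))) +
    (2 * L + 1) * (2 * Real.sqrt (L / ek L A j)))

lemma corner (h : GoodCarpet L A) (k : ℕ) : ∀ (f : ℝ × ℝ → ℝ) (a M E : ℝ) (l r : ℝ × ℝ),
    0 < E → En L A k f ≤ E → l.1 = 0 → r.1 = 1 →
    Pth L A k {z | |f z - a| ≤ M} l r → |f (0, 0) - a| ≤ M + Bk L A k * Real.sqrt E := by
  have hL := h.three_le
  have hL0 : (0 : ℝ) < L := by positivity
  induction k with
  | zero =>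
    intro f a M E l r hE hf hl hr hp
    have hs := Real.sqrt_nonneg E
    simp only [Bk, Finset.range_zero, Finset.sum_empty, add_zero, one_mul]
    rcases hp.cases_head with e | ⟨s, hs', _⟩
    · rw [e, hr] at hl; norm_num at hl
    · obtain ⟨⟨hl0, -, -⟩, hlZ, -⟩ := hs'
      simp only [Set.mem_ofPred_eq] at hlZ
      rw [mem_V0] at hl0
      rcases hl0 with rfl | rfl | rfl | rfl
      · linarith
      · norm_num at hl
      · norm_num at hl
      · have h1 : |f (0, 1) - f (0, 0)| ≤ Real.sqrt E := by
          apply Real.abs_le_sqrt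
          simp only [En, qf] at hf
          nlinarith [sq_nonneg (f (0, 0) - f (1, 0)), sq_nonneg (f (1, 0) - f (1, 1)),
            sq_nonneg (f (1, 1) - f (0, 1))]
        rw [abs_le] at *
        constructor <;> linarith [h1.1, h1.2, hlZ.1, hlZ.2]
  | succ k ih =>
    intro f a M E l r hE hf hl hr hp
    have hs := Real.sqrt_pos.2 hE
    have hsq := Real.sq_sqrt hE.le
    have he1 := ek_pos h (k + 1)
    have he0 := ek_pos h k
    set s := Real.sqrt E with hsdef
    set c := 2 * Real.sqrt (1 / ek L A (k + 1)) * s with hc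
    set c' := 2 * Real.sqrt (L / ek L A k) * s with hc'
    have hcpos : 0 < c := by positivity
    have hcpos' : 0 < c' := by positivity
    have hc2 : c ^ 2 * ek L A (k + 1) = 4 * E := by
      rw [hc, mul_pow, mul_pow, Real.sq_sqrt (by positivity), hsq]; field_simp; norm_num
    have hc2' : c' ^ 2 * ek L A k = 4 * L * E := by
      rw [hc', mul_pow, mul_pow, Real.sq_sqrt (by positivity), hsq]; field_simp; norm_num
    -- bottom to top crossing
    obtain ⟨b, t, hb, ht, hbt⟩ := crossing h (k + 1) (ι := Unit) (fun _ x => f x.swap) c hcpos (by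
      simp only [Fintype.card_unit, Finset.univ_unique, Finset.sum_singleton]
      rw [En_swap h, hc2]; push_cast; linarith)
    have hbt' : Pth L A (k + 1) {z | |f z - f b.swap| ≤ c} b.swap t.swap := by
      refine Pth_map Prod.swap (fun x y he => Edge_swap h he) ?_ hbt
      intro z hz; exact hz ()
    -- small scale crossings
    obtain ⟨l', r', hl', hr', hlr'⟩ := crossing h k (ι := Fin L)
      (fun i x => f (Psi L ((i : ℕ), 0) (fold i x))) c' hcpos' (by
      rw [Fintype.card_fin, hc2']
      have := bottom_sum h k f
      nlinarith)
    have hun := (unfolding h k f c' l' r' hl' hr' hlr' (L - 1) (by omega)).2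
    have hLm : ((L - 1 : ℕ) : ℝ) = L - 1 := by rw [Nat.cast_sub (by omega)]; simp
    obtain ⟨z1, hz1, hz1'⟩ := planar h (k + 1) _ _ l r b.swap t.swap hp hbt' hl hr
      (by simpa using hb) (by simpa using ht)
    obtain ⟨z2, hz2, hz2'⟩ := planar h (k + 1) _ _ _ _ b.swap t.swap hun hbt'
      (by simp [Psi, hl']) (by
        simp only [Psi, hLm]
        rw [div_eq_one_iff_eq hL0.ne']
        unfold fold
        split_ifs <;> simp [Hr, hl', hr'])
      (by simpa using hb) (by simpa using ht)
    have hih := ih (fun x => f (Psi L (0, 0) x)) (f (Psi L (0, 0) l')) c' E l' r' hE (by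
        refine le_trans ?_ hf
        simp only [En]
        exact Finset.single_le_sum (f := fun a => En L A k (fun x => f (Psi L a x)))
          (fun a _ => En_nonneg _ _) (bottom_mem h (by omega))) hl' hr' (by
        refine Pth_mono ?_ hlr'
        intro z hz
        have := hz ⟨0, by omega⟩
        simpa [fold] using this)
    have hz0 : Psi L (0, 0) (0, 0) = (0, 0) := by simp [Psi]
    rw [hz0] at hih
    have hB : Bk L A (k + 1) * s = Bk L A k * s + 2 * c + (2 * L + 1) * c' := by
      rw [hc, hc', Bk, Bk, Finset.sum_range_succ]; ring
    rw [hB]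
    simp only [Set.mem_ofPred_eq, hLm] at hz1 hz1' hz2 hz2'
    rw [abs_le] at *
    constructor <;> nlinarith [hz1.1, hz1.2, hz1'.1, hz1'.2, hz2.1, hz2.2, hz2'.1, hz2'.2,
      hih.1, hih.2]

lemma corner_to_corner (h : GoodCarpet L A) (k : ℕ) (f : ℝ × ℝ → ℝ) :
    (f (0, 0) - f (1, 0)) ^ 2 ≤
      (4 * Real.sqrt (1 / ek L A k) + 2 * Bk L A k) ^ 2 * En L A k f := by
  have he0 := ek_pos h k
  have hB : 0 ≤ Bk L A k := by unfold Bk; positivity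
  have key : ∀ E, 0 < E → En L A k f ≤ E → (f (0, 0) - f (1, 0)) ^ 2 ≤
      (4 * Real.sqrt (1 / ek L A k) + 2 * Bk L A k) ^ 2 * E := by
    intro E hE hf
    have hs := Real.sqrt_pos.2 hE
    have hsq := Real.sq_sqrt hE.le
    set s := Real.sqrt E with hsdef
    set c := 2 * Real.sqrt (1 / ek L A k) * s with hc
    have hcpos : 0 < c := by positivity
    have hc2 : c ^ 2 * ek L A k = 4 * E := by
      rw [hc, mul_pow, mul_pow, Real.sq_sqrt (by positivity), hsq]; field_simp; norm_num
    obtain ⟨l, r, hl, hr, hlr⟩ := crossing h k (ι := Unit) (fun _ x => f x) c hcpos (by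
      simp only [Fintype.card_unit, Finset.univ_unique, Finset.sum_singleton]
      rw [hc2]; push_cast; linarith)
    have hp : Pth L A k {z | |f z - f l| ≤ c} l r :=
      Pth_mono (Z := {z | ∀ _ : Unit, |f z - f l| ≤ c}) (fun z hz => hz ()) hlr
    have h1 := corner h k f (f l) c E l r hE hf hl hr hp
    have h2 := corner h k (fun x => f (Hr x)) (f l) c E (Hr r) (Hr l) hE (by rw [En_Hr h]; exact hf)
      (by simp [Hr, hr]) (by simp [Hr, hl])
      (Pth_map Hr (fun x y he => Edge_Hr h he) (fun z hz => by simpa [Hr_Hr] using hz)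
        (Pth_symm hp))
    have h3 : Hr (0, 0) = (1, 0) := by simp [Hr]
    rw [h3] at h2
    have h4 : |f (0, 0) - f (1, 0)| ≤ (4 * Real.sqrt (1 / ek L A k) + 2 * Bk L A k) * s := by
      have : (4 * Real.sqrt (1 / ek L A k) + 2 * Bk L A k) * s = 2 * c + 2 * (Bk L A k * s) := by
        rw [hc]; ring
      rw [this]
      rw [abs_le] at *
      constructor <;> linarith [h1.1, h1.2, h2.1, h2.2]
    rw [← sq_abs, ← hsq, ← mul_pow]
    exact pow_le_pow_left₀ (abs_nonneg _) h4 2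
  refine le_of_forall_pos_le_add fun ε hε => ?_
  set K := (4 * Real.sqrt (1 / ek L A k) + 2 * Bk L A k) ^ 2 with hK
  have hKpos : 0 < K := by positivity
  have h0 := En_nonneg (L := L) (A := A) k f
  have := key (En L A k f + ε / K) (by positivity) (by
    have : 0 < ε / K := by positivity
    linarith)
  rw [mul_add, mul_div_cancel₀ _ hKpos.ne'] at this
  exact this

/-! ### Extension of functions by self-similar interpolation -/

/-- Bilinear interpolation. -/
def bil (a b c d u v : ℝ) : ℝ :=
  a * u * v + b * (1 - u) * v + c * u * (1 - v) + d * (1 - u) * (1 - v)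

lemma convex_sq {a b v q : ℝ} (hv : 0 ≤ v) (hv' : v ≤ 1) (ha : a ^ 2 ≤ q) (hb : b ^ 2 ≤ q) :
    (a * v + b * (1 - v)) ^ 2 ≤ q := by
  have h1 : (a * v + b * (1 - v)) ^ 2 ≤ a ^ 2 * v + b ^ 2 * (1 - v) := by
    nlinarith [mul_nonneg (mul_nonneg hv (sub_nonneg.2 hv')) (sq_nonneg (a - b))]
  nlinarith

lemma two_sq_bound (P Q s t q : ℝ) (h1 : P ^ 2 ≤ q) (h2 : Q ^ 2 ≤ q) :
    (P * s + Q * t) ^ 2 ≤ (2 * q) * (s ^ 2 + t ^ 2) := by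
  have e0 := sq_nonneg (P * s - Q * t)
  have e1 : (P * s + Q * t) ^ 2 =
      2 * (P ^ 2 * s ^ 2 + Q ^ 2 * t ^ 2) - (P * s - Q * t) ^ 2 := by ring
  have e2 : P ^ 2 * s ^ 2 ≤ q * s ^ 2 := mul_le_mul_of_nonneg_right h1 (sq_nonneg _)
  have e3 : Q ^ 2 * t ^ 2 ≤ q * t ^ 2 := mul_le_mul_of_nonneg_right h2 (sq_nonneg _)
  linarith

lemma bil_diff (a b c d u v u' v' : ℝ) (hv : 0 ≤ v) (hv1 : v ≤ 1) (hu : 0 ≤ u') (hu1 : u' ≤ 1) :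
    (bil a b c d u v - bil a b c d u' v') ^ 2 ≤
      (2 * ((a - b) ^ 2 + (b - d) ^ 2 + (d - c) ^ 2 + (c - a) ^ 2)) *
        ((u - u') ^ 2 + (v - v') ^ 2) := by
  have n1 := sq_nonneg (a - b)
  have n2 := sq_nonneg (b - d)
  have n3 := sq_nonneg (d - c)
  have n4 := sq_nonneg (c - a)
  have f1 : (c - d) ^ 2 = (d - c) ^ 2 := by ring
  have f2 : (a - c) ^ 2 = (c - a) ^ 2 := by ring
  have e : bil a b c d u v - bil a b c d u' v' =
      ((a - b) * v + (c - d) * (1 - v)) * (u - u') +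
        ((a - c) * u' + (b - d) * (1 - u')) * (v - v') := by
    simp only [bil]; ring
  rw [e]
  refine two_sq_bound _ _ _ _ _ (convex_sq hv hv1 ?_ ?_) (convex_sq hu hu1 ?_ ?_)
  · linarith only [n2, n3, n4]
  · rw [f1]; linarith only [n1, n2, n4]
  · rw [f2]; linarith only [n1, n2, n3]
  · linarith only [n1, n3, n4]

/-- Admissible profiles. -/
structure GH (g : ℝ × ℝ → ℝ) : Prop where
  lr : IsLR g
  nonneg : ∀ x, 0 ≤ g x
  le_one : ∀ x, g x ≤ 1
  symm : ∀ x y, g (x, 1 - y) = g (x, y)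

lemma En_V (h : GoodCarpet L A) (k : ℕ) (f : ℝ × ℝ → ℝ) :
    En L A k (fun x => f (x.1, 1 - x.2)) = En L A k f := by
  rw [← En_swap h k f, ← En_Hr h k (fun x => f x.swap),
    ← En_swap h k (fun x => f (Hr x).swap)]
  rfl

lemma good_near (h : GoodCarpet L A) (k : ℕ) : ∃ g, GH g ∧ En L A k g ≤ 2 * ek L A k := by
  obtain ⟨f, hf, hE⟩ := ek_near h k
  let f1 : ℝ × ℝ → ℝ := fun x => max 0 (min 1 (f x))
  have h1 : En L A k f1 ≤ 1 * En L A k f := by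
    refine En_mono_one k 1 _ _ ?_
    intro x y _
    rw [one_mul, sq_le_sq]
    have e1 := abs_max_sub_max_le_abs (min 1 (f x)) (min 1 (f y)) 0
    have e2 := abs_min_sub_min_le_max 1 (f x) 1 (f y)
    simp only [sub_self, abs_zero] at e2
    rw [max_eq_right (abs_nonneg _)] at e2
    rw [max_comm (min 1 (f x)), max_comm (min 1 (f y))] at e1
    exact e1.trans e2
  have b0 : ∀ x, 0 ≤ f1 x := fun x => le_max_left _ _
  have b1 : ∀ x, f1 x ≤ 1 := fun x => max_le zero_le_one (min_le_left _ _)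
  refine ⟨fun x => (f1 x + f1 (x.1, 1 - x.2)) / 2, ⟨⟨?_, ?_⟩, ?_, ?_, ?_⟩, ?_⟩
  · intro y; simp [f1, hf.1]
  · intro y; simp [f1, hf.2]
  · intro x; have := b0 x; have := b0 (x.1, 1 - x.2); linarith
  · intro x; have := b1 x; have := b1 (x.1, 1 - x.2); linarith
  · intro x y; simp only [sub_sub_cancel]; ring
  · have := En_mono_two (L := L) (A := A) k (1 / 2) (fun x => (f1 x + f1 (x.1, 1 - x.2)) / 2) f1
      (fun x => f1 (x.1, 1 - x.2)) (by
        intro x y _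
        nlinarith [sq_nonneg ((f1 x - f1 y) - (f1 (x.1, 1 - x.2) - f1 (y.1, 1 - y.2)))])
    rw [En_V h] at this
    linarith

/-- Extension of `f` from level `n` (mesh `1/N`) using the profile `g` in each cell. -/
noncomputable def Ext (g f : ℝ × ℝ → ℝ) (N : ℝ) (x : ℝ × ℝ) : ℝ :=
  bil (f (⌊N * x.1⌋ / N, ⌊N * x.2⌋ / N)) (f ((⌊N * x.1⌋ + 1) / N, ⌊N * x.2⌋ / N))
    (f (⌊N * x.1⌋ / N, (⌊N * x.2⌋ + 1) / N)) (f ((⌊N * x.1⌋ + 1) / N, (⌊N * x.2⌋ + 1) / N))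
    (g (Int.fract (N * x.1), Int.fract (N * x.2))) (g (Int.fract (N * x.2), Int.fract (N * x.1)))

lemma Ext_one {g f : ℝ × ℝ → ℝ} (hg : GH g) {x : ℝ × ℝ} (hx : 0 ≤ x.1 ∧ x.1 ≤ 1)
    (hy : 0 ≤ x.2 ∧ x.2 ≤ 1) :
    Ext g f 1 x = bil (f (0, 0)) (f (1, 0)) (f (0, 1)) (f (1, 1)) (g x) (g x.swap) := by
  obtain ⟨x, y⟩ := x
  simp only at hx hy
  have s1 : ∀ x, g (x, 1) = g (x, 0) := fun x => by simpa using hg.symm x 0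
  simp only [Ext, one_mul, div_one, Prod.swap]
  rcases hx.2.eq_or_lt with rfl | hx1 <;> rcases hy.2.eq_or_lt with rfl | hy1
  · simp [bil, hg.lr.1, hg.lr.2]
  · have e1 : ⌊y⌋ = 0 := Int.floor_eq_zero_iff.2 ⟨hy.1, hy1⟩
    have e2 : Int.fract y = y := Int.fract_eq_self.2 ⟨hy.1, hy1⟩
    simp [bil, hg.lr.1, hg.lr.2, e1, e2, s1]
  · have e1 : ⌊x⌋ = 0 := Int.floor_eq_zero_iff.2 ⟨hx.1, hx1⟩
    have e2 : Int.fract x = x := Int.fract_eq_self.2 ⟨hx.1, hx1⟩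
    simp [bil, hg.lr.1, hg.lr.2, e1, e2, s1]
  · have e1 : ⌊y⌋ = 0 := Int.floor_eq_zero_iff.2 ⟨hy.1, hy1⟩
    have e2 : Int.fract y = y := Int.fract_eq_self.2 ⟨hy.1, hy1⟩
    have e3 : ⌊x⌋ = 0 := Int.floor_eq_zero_iff.2 ⟨hx.1, hx1⟩
    have e4 : Int.fract x = x := Int.fract_eq_self.2 ⟨hx.1, hx1⟩
    simp [e1, e2, e3, e4]

lemma Ext_Psi (hL : 3 ≤ L) (g f : ℝ × ℝ → ℝ) (n : ℕ) (a : ℕ × ℕ) (x : ℝ × ℝ) :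
    Ext g f ((L : ℝ) ^ (n + 1)) (Psi L a x) =
      Ext g (fun z => f (Psi L a z)) ((L : ℝ) ^ n) x := by
  have hL0 : (L : ℝ) ≠ 0 := by positivity
  have e : ∀ (t : ℝ) (b : ℕ), (L : ℝ) ^ (n + 1) * ((t + b) / L) =
      (L : ℝ) ^ n * t + ((L ^ n * b : ℕ) : ℝ) := by
    intro t b; push_cast; rw [pow_succ]; field_simp
  have e1 : ∀ (t : ℝ) (b : ℕ), (t + ((L ^ n * b : ℕ) : ℝ)) / (L : ℝ) ^ (n + 1) =
      (t / (L : ℝ) ^ n + b) / L := by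
    intro t b; push_cast; rw [pow_succ]; field_simp
  have e2 : ∀ (t : ℝ) (b : ℕ), (t + ((L ^ n * b : ℕ) : ℝ) + 1) / (L : ℝ) ^ (n + 1) =
      ((t + 1) / (L : ℝ) ^ n + b) / L := by
    intro t b; rw [← e1]; ring
  simp only [Ext, Psi, e, Int.floor_add_natCast, Int.fract_add_natCast, Int.cast_add,
    Int.cast_natCast, e1, e2]

lemma Ext_energy (h : GoodCarpet L A) (k : ℕ) {g : ℝ × ℝ → ℝ} (hg : GH g) (n : ℕ) :
    ∀ f : ℝ × ℝ → ℝ, En L A (k + n) (Ext g f ((L : ℝ) ^ n)) ≤ 4 * En L A k g * En L A n f := by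
  induction n with
  | zero =>
    intro f
    have := En_mono_two (L := L) (A := A) k (2 * qf f) (Ext g f ((L : ℝ) ^ 0)) g
      (fun x => g x.swap) (by
        intro x y he
        have b1 := Edge_box h he
        have b2 := Edge_box h (Edge_symm he)
        rw [pow_zero, Ext_one hg b1.1 b1.2, Ext_one hg b2.1 b2.2]
        exact bil_diff _ _ _ _ _ _ _ _ (hg.nonneg _) (hg.le_one _) (hg.nonneg _) (hg.le_one _))
    rw [En_swap h] at this
    simp only [add_zero, En] at this ⊢
    linarith
  | succ n ih =>
    intro f
    rw [← add_assoc]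
    simp only [En]
    rw [Finset.mul_sum]
    refine Finset.sum_le_sum fun a _ => ?_
    simp only [Ext_Psi h.three_le]
    exact ih _

lemma Ext_zero {g f : ℝ × ℝ → ℝ} (hg : GH g) {N : ℝ} :
    Ext g f N (0, 0) = f (0, 0) := by
  simp [Ext, bil, hg.lr.1]

lemma Ext_corner {g f : ℝ × ℝ → ℝ} (hg : GH g) (n : ℕ) (hL : 3 ≤ L) :
    Ext g f ((L : ℝ) ^ n) (1, 0) = f (1, 0) := by
  have h0 : (L : ℝ) ^ n ≠ 0 := by positivity
  have e : (L : ℝ) ^ n = ((L ^ n : ℕ) : ℝ) := by push_cast; rfl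
  have e1 : ⌊(L : ℝ) ^ n⌋ = ((L ^ n : ℕ) : ℤ) := by rw [e, Int.floor_natCast]
  have e2 : Int.fract ((L : ℝ) ^ n) = 0 := by rw [e, Int.fract_natCast]
  have e3 : (((L ^ n : ℕ) : ℤ) : ℝ) / (L : ℝ) ^ n = 1 := by
    push_cast; exact div_self h0
  simp only [Ext, mul_one, mul_zero, e1, e2, e3, Int.floor_zero, Int.fract_zero, bil, hg.lr.1]
  simp

lemma Ext_LR {g f : ℝ × ℝ → ℝ} (hg : GH g) (hf : IsLR f) (n : ℕ) (hL : 3 ≤ L) :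
    IsLR (Ext g f ((L : ℝ) ^ n)) := by
  have h0 : (L : ℝ) ^ n ≠ 0 := by positivity
  have e : (L : ℝ) ^ n = ((L ^ n : ℕ) : ℝ) := by push_cast; rfl
  have e1 : ⌊(L : ℝ) ^ n⌋ = ((L ^ n : ℕ) : ℤ) := by rw [e, Int.floor_natCast]
  have e2 : Int.fract ((L : ℝ) ^ n) = 0 := by rw [e, Int.fract_natCast]
  have e3 : (((L ^ n : ℕ) : ℤ) : ℝ) / (L : ℝ) ^ n = 1 := by
    push_cast; exact div_self h0
  constructor
  · intro y
    simp only [Ext, mul_zero, Int.floor_zero, Int.fract_zero, bil, hg.lr.1, Int.cast_zero,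
      zero_div, hf.1]
    ring
  · intro y
    simp only [Ext, mul_one, e1, e2, e3, bil, hg.lr.1, hf.2]
    ring

/-! ### Resistance estimates -/

/-- Corner-to-corner conductance for `En`. -/
noncomputable def sk (L : ℕ) (A : Finset (ℕ × ℕ)) (k : ℕ) : ℝ :=
  sInf {e : ℝ | ∃ f : ℝ × ℝ → ℝ, f (0, 0) = 1 ∧ f (1, 0) = 0 ∧ e = En L A k f}

lemma sk_le {k : ℕ} {f : ℝ × ℝ → ℝ} (h0 : f (0, 0) = 1) (h1 : f (1, 0) = 0) :
    sk L A k ≤ En L A k f := by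
  refine csInf_le ⟨0, ?_⟩ ⟨f, h0, h1, rfl⟩
  rintro e ⟨f, -, -, rfl⟩
  exact En_nonneg _ _

lemma le_sk {k : ℕ} {s : ℝ} (hs : ∀ f : ℝ × ℝ → ℝ, f (0, 0) = 1 → f (1, 0) = 0 → s ≤ En L A k f) :
    s ≤ sk L A k := by
  refine le_csInf ⟨_, fun x => (-1) * x.1 + 1, linear_LR.1 0, linear_LR.2 0, rfl⟩ ?_
  rintro e ⟨f, h0, h1, rfl⟩
  exact hs f h0 h1

lemma sk_pos (h : GoodCarpet L A) (k : ℕ) : 0 < sk L A k := by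
  have hL := h.three_le
  have hL0 : (0 : ℝ) < L := by positivity
  have : ((L : ℝ) ^ k)⁻¹ ≤ sk L A k := by
    refine le_sk fun f h0 h1 => ?_
    have := En_corner_crude h k f
    rw [h0, h1] at this
    rw [inv_le_iff_one_le_mul₀ (by positivity)]
    linarith
  exact lt_of_lt_of_le (by positivity) this

lemma sk_ext (h : GoodCarpet L A) (k n : ℕ) :
    sk L A (k + n) ≤ 8 * ek L A k * sk L A n := by
  have he := ek_pos h k
  have : sk L A (k + n) / (8 * ek L A k) ≤ sk L A n := by
    refine le_sk fun f h0 h1 => ?_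
    obtain ⟨g, hg, hE⟩ := good_near h k
    have e1 := Ext_energy h k hg n f
    have e2 : sk L A (k + n) ≤ En L A (k + n) (Ext g f ((L : ℝ) ^ n)) :=
      sk_le (by rw [Ext_zero hg, h0]) (by rw [Ext_corner hg n h.three_le, h1])
    rw [div_le_iff₀ (by positivity)]
    have := En_nonneg (L := L) (A := A) n f
    nlinarith
  rw [div_le_iff₀ (by positivity)] at this
  linarith

/-- The ratio `#A / L²`. -/
noncomputable def th (L : ℕ) (A : Finset (ℕ × ℕ)) : ℝ := (A.card : ℝ) / (L : ℝ) ^ 2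

lemma th_nonneg : 0 ≤ th L A := by unfold th; positivity

lemma th_lt_one (h : GoodCarpet L A) : th L A < 1 := by
  have hL := h.three_le
  have hL0 : (0 : ℝ) < (L : ℝ) ^ 2 := by positivity
  unfold th
  rw [div_lt_one hL0]
  have : A.card < L ^ 2 := by
    have e : (Finset.range L ×ˢ Finset.range L).card = L ^ 2 := by simp [sq]
    rw [← e]
    refine Finset.card_lt_card ⟨?_, ?_⟩
    · intro p hp
      have := h.mem_lt p hp
      simp [this.1, this.2]
    · intro hsub
      obtain ⟨a, b, ha, hb, hab⟩ := h.proper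
      exact hab (hsub (by simp [ha, hb]))
  exact_mod_cast this

lemma ek_growth (h : GoodCarpet L A) (k n : ℕ) :
    ek L A (k + n) ≤ 16 * th L A ^ n * ek L A k := by
  obtain ⟨g, hg, hE⟩ := good_near h k
  have e1 := Ext_energy h k hg n (fun x => (-1) * x.1 + 1)
  have e2 := ek_le (L := L) (A := A) (k := k + n) (Ext_LR hg linear_LR n h.three_le)
  rw [En_linear h] at e1
  have e3 : 0 ≤ th L A ^ n := pow_nonneg th_nonneg n
  have e4 : ((A.card : ℝ) / (L : ℝ) ^ 2) ^ n = th L A ^ n := rfl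
  rw [e4] at e1
  nlinarith

lemma ek_le_two (h : GoodCarpet L A) (k : ℕ) : ek L A k ≤ 2 := by
  have e2 := ek_le (L := L) (A := A) (k := k) linear_LR
  rw [En_linear h] at e2
  have e4 : ((A.card : ℝ) / (L : ℝ) ^ 2) ^ k = th L A ^ k := rfl
  have e3 : th L A ^ k ≤ 1 := pow_le_one₀ th_nonneg (th_lt_one h).le
  rw [e4] at e2
  linarith

lemma Bk_bound (h : GoodCarpet L A) : ∃ C : ℝ, 0 < C ∧ ∀ k,
    4 * Real.sqrt (1 / ek L A k) + 2 * Bk L A k ≤ C * Real.sqrt (1 / ek L A k) := by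
  set β := Real.sqrt (th L A) with hβ
  have hβ0 : 0 ≤ β := Real.sqrt_nonneg _
  have hβ1 : β < 1 := by
    rw [hβ, Real.sqrt_lt' one_pos]; simpa using th_lt_one h
  have hgrow : ∀ j i, Real.sqrt (1 / ek L A j) ≤ 4 * β ^ i * Real.sqrt (1 / ek L A (j + i)) := by
    intro j i
    have e0 := ek_pos h j
    have e1 := ek_pos h (j + i)
    have e2 := ek_growth h j i
    rw [Real.sqrt_le_left (by positivity), mul_pow, mul_pow, Real.sq_sqrt (by positivity),
      ← pow_mul, mul_comm i 2, pow_mul, hβ, Real.sq_sqrt th_nonneg, mul_one_div, div_le_div_iff₀ e0 e1]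
    nlinarith
  set D : ℝ := 4 + (2 * L + 1) * (2 * Real.sqrt L) with hD
  have hDpos : 0 < D := by positivity
  have h1β : 0 < 1 - β := by linarith
  refine ⟨4 + 2 * (2 + D * (4 / (1 - β))), by positivity, ?_⟩
  intro k
  have ekp := ek_pos h k
  set G := Real.sqrt (1 / ek L A k) with hG
  have hG0 : 0 ≤ G := Real.sqrt_nonneg _
  have hone : 1 ≤ 2 * G := by
    have : (1 / 2 : ℝ) ≤ G := by
      rw [hG]
      apply Real.le_sqrt_of_sq_le
      rw [le_div_iff₀ ekp]
      have := ek_le_two h k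
      linarith
    linarith
  have hsum : ∑ j ∈ Finset.range k, (2 * (2 * Real.sqrt (1 / ek L A (j + 1))) +
      (2 * L + 1) * (2 * Real.sqrt (L / ek L A j))) ≤ D * (4 / (1 - β)) * G := by
    calc _ ≤ ∑ j ∈ Finset.range k, D * 4 * G * β ^ (k - 1 - j) := by
          refine Finset.sum_le_sum fun j hj => ?_
          have hj := Finset.mem_range.1 hj
          have a1 := hgrow (j + 1) (k - 1 - j)
          have a2 := hgrow j (k - 1 - j + 1)
          rw [show j + 1 + (k - 1 - j) = k by omega] at a1
          rw [show j + (k - 1 - j + 1) = k by omega] at a2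
          have a3 : β ^ (k - 1 - j + 1) ≤ β ^ (k - 1 - j) :=
            pow_le_pow_of_le_one hβ0 hβ1.le (by omega)
          have a4 : Real.sqrt (1 / ek L A j) ≤ 4 * β ^ (k - 1 - j) * G := by
            refine a2.trans ?_
            gcongr
          have a5 : Real.sqrt (L / ek L A j) = Real.sqrt L * Real.sqrt (1 / ek L A j) := by
            rw [← Real.sqrt_mul (by positivity), mul_one_div]
          rw [a5]
          have a6 : (2 * (L : ℝ) + 1) * (2 * (Real.sqrt L * Real.sqrt (1 / ek L A j))) ≤
              (2 * (L : ℝ) + 1) * (2 * (Real.sqrt L * (4 * β ^ (k - 1 - j) * G))) := by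
            gcongr
          calc _ ≤ 2 * (2 * (4 * β ^ (k - 1 - j) * G)) +
                (2 * (L : ℝ) + 1) * (2 * (Real.sqrt L * (4 * β ^ (k - 1 - j) * G))) := by linarith
            _ = _ := by rw [hD]; ring
      _ = D * 4 * G * ∑ j ∈ Finset.range k, β ^ j := by
          rw [← Finset.mul_sum, Finset.sum_range_reflect (fun j => β ^ j)]
      _ ≤ D * 4 * G * (1 / (1 - β)) := by
          gcongr
          rw [one_div, ← tsum_geometric_of_lt_one hβ0 hβ1]
          exact (summable_geometric_of_lt_one hβ0 hβ1).sum_le_tsum _ fun i _ => pow_nonneg hβ0 i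
      _ = _ := by ring
  unfold Bk
  nlinarith

lemma ek_le_sk (h : GoodCarpet L A) : ∃ C : ℝ, 0 < C ∧ ∀ k, ek L A k ≤ C * sk L A k := by
  obtain ⟨C, hC, hB⟩ := Bk_bound h
  refine ⟨C ^ 2, by positivity, fun k => ?_⟩
  have e0 := ek_pos h k
  have : ek L A k / C ^ 2 ≤ sk L A k := by
    refine le_sk fun f h0 h1 => ?_
    have e1 := corner_to_corner h k f
    rw [h0, h1] at e1
    have hB0 : 0 ≤ Bk L A k := by
      unfold Bk; positivity
    have e2 : (4 * Real.sqrt (1 / ek L A k) + 2 * Bk L A k) ^ 2 ≤ C ^ 2 * (1 / ek L A k) := by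
      rw [← Real.sq_sqrt (show 0 ≤ 1 / ek L A k by positivity), ← mul_pow]
      rw [Real.sq_sqrt (show 0 ≤ 1 / ek L A k by positivity)]
      exact pow_le_pow_left₀ (by positivity) (hB k) 2
    have e3 := mul_le_mul_of_nonneg_right e2 (En_nonneg (L := L) (A := A) k f)
    have e4 : 1 ≤ C ^ 2 * (1 / ek L A k) * En L A k f := by linarith
    rw [mul_one_div, div_mul_eq_mul_div, le_div_iff₀ e0] at e4
    rw [div_le_iff₀ (by positivity)]
    linarith
  rw [div_le_iff₀ (by positivity)] at this
  linarith

lemma sk_corner (k : ℕ) (f : ℝ × ℝ → ℝ) :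
    sk L A k * (f (0, 0) - f (1, 0)) ^ 2 ≤ En L A k f := by
  by_cases hd : f (0, 0) - f (1, 0) = 0
  · rw [hd]; simpa using En_nonneg k f
  · have e1 : sk L A k ≤ En L A k (fun x => (f x - f (1, 0)) / (f (0, 0) - f (1, 0))) :=
      sk_le (by simp [hd]) (by simp)
    have e2 := En_mono_one (L := L) (A := A) k (1 / (f (0, 0) - f (1, 0)) ^ 2)
      (fun x => (f x - f (1, 0)) / (f (0, 0) - f (1, 0))) f (by
        intro x y _
        apply le_of_eq
        field_simp
        ring)
    have hp : 0 < (f (0, 0) - f (1, 0)) ^ 2 := by positivity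
    rw [one_div_mul_eq_div, le_div_iff₀ hp] at e2
    nlinarith

lemma sk_trace (h : GoodCarpet L A) (k n : ℕ) : ∀ f : ℝ × ℝ → ℝ,
    sk L A k * En L A n f ≤ 4 * En L A (k + n) f := by
  induction n with
  | zero =>
    intro f
    have e1 := sk_corner (L := L) (A := A) k f
    have e2 := sk_corner (L := L) (A := A) k (fun x => f x.swap)
    have e3 := sk_corner (L := L) (A := A) k (fun x => f (Hr x.swap))
    have e4 := sk_corner (L := L) (A := A) k (fun x => f (x.1, 1 - x.2))
    rw [En_swap h] at e2
    rw [En_swap h k (fun x => f (Hr x)), En_Hr h] at e3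
    rw [En_V h] at e4
    simp only [Prod.swap, Hr, sub_zero, sub_self] at e2 e3 e4
    simp only [En, qf, add_zero]
    nlinarith
  | succ n ih =>
    intro f
    rw [← add_assoc]
    simp only [En]
    rw [Finset.mul_sum, Finset.mul_sum]
    exact Finset.sum_le_sum fun a _ => ih _

lemma sk_mul (h : GoodCarpet L A) (k n : ℕ) : sk L A n * sk L A k ≤ 4 * sk L A (k + n) := by
  have : sk L A n * sk L A k / 4 ≤ sk L A (k + n) := by
    refine le_sk fun f h0 h1 => ?_
    have e1 := sk_trace h k n f
    have e2 := sk_le (L := L) (A := A) (k := n) h0 h1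
    have e3 := sk_pos h k
    nlinarith
  linarith

/-! ### Comparison with the graph energy -/

lemma PsiW_succ {n : ℕ} (w : Word A (n + 1)) (x : ℝ × ℝ) :
    PsiW L w x = Psi L (w 0).1 (PsiW L (Fin.tail w : Word A n) x) := by
  simp [PsiW, List.ofFn_succ, Fin.tail]

lemma PsiW_zero (w : Word A 0) (x : ℝ × ℝ) : PsiW L w x = x := by
  simp [PsiW]

lemma En_eq_sum (n : ℕ) : ∀ f : ℝ × ℝ → ℝ,
    En L A n f = ∑ w : Word A n, qf (fun x => f (PsiW L w x)) := by
  induction n with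
  | zero => intro f; simp [En, PsiW_zero]
  | succ n ih =>
    intro f
    simp only [En]
    rw [← Finset.sum_coe_sort A (fun a => En L A n (fun x => f (Psi L a x)))]
    rw [← Equiv.sum_comp (Fin.consEquiv (fun _ : Fin (n + 1) => {p : ℕ × ℕ // p ∈ A})),
      Fintype.sum_prod_type]
    refine Finset.sum_congr rfl fun a _ => ?_
    rw [ih]
    refine Finset.sum_congr rfl fun w _ => ?_
    simp [PsiW_succ, Fin.consEquiv]

lemma PsiW_affine (h : GoodCarpet L A) {n : ℕ} (p : ℝ × ℝ) : ∀ w : Word A n,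
    PsiW L w p = ((PsiW L w (0, 0)).1 + p.1 / (L : ℝ) ^ n,
      (PsiW L w (0, 0)).2 + p.2 / (L : ℝ) ^ n) := by
  have hL := h.three_le
  have hL0 : (L : ℝ) ≠ 0 := by positivity
  induction n with
  | zero => intro w; simp [PsiW_zero]
  | succ n ih =>
    intro w
    rw [PsiW_succ, PsiW_succ, ih]
    simp only [Psi, pow_succ]
    ext
    · simp; field_simp; ring
    · simp; field_simp; ring

lemma PsiW_range (h : GoodCarpet L A) {n : ℕ} : ∀ w : Word A n,
    (0 ≤ (PsiW L w (0, 0)).1 ∧ (PsiW L w (0, 0)).1 < 1) ∧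
    (0 ≤ (PsiW L w (0, 0)).2 ∧ (PsiW L w (0, 0)).2 < 1) := by
  have hL := h.three_le
  have hL0 : (0 : ℝ) < L := by positivity
  induction n with
  | zero => intro w; simp [PsiW_zero]
  | succ n ih =>
    intro w
    rw [PsiW_succ]
    obtain ⟨⟨b1, b2⟩, b3, b4⟩ := ih (Fin.tail w)
    obtain ⟨c1, c2⟩ := h.mem_lt _ (w 0).2
    have d1 : ((w 0).1.1 : ℝ) + 1 ≤ L := by exact_mod_cast c1
    have d2 : ((w 0).1.2 : ℝ) + 1 ≤ L := by exact_mod_cast c2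
    refine ⟨⟨?_, ?_⟩, ?_, ?_⟩ <;> simp only [Psi]
    · positivity
    · rw [div_lt_one hL0]; linarith
    · positivity
    · rw [div_lt_one hL0]; linarith

lemma digit_eq {a b : ℕ} {s t : ℝ} (hs : 0 ≤ s ∧ s < 1) (ht : 0 ≤ t ∧ t < 1)
    (e : s + a = t + b) : a = b ∧ s = t := by
  have h1 : (a : ℝ) < b + 1 := by linarith [hs.1, ht.2]
  have h2 : (b : ℝ) < a + 1 := by linarith [ht.1, hs.2]
  have h3 : a < b + 1 := by exact_mod_cast h1
  have h4 : b < a + 1 := by exact_mod_cast h2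
  have h5 : a = b := by omega
  subst h5
  exact ⟨rfl, by linarith⟩

lemma PsiW_inj0 (h : GoodCarpet L A) {n : ℕ} : ∀ w w' : Word A n,
    PsiW L w (0, 0) = PsiW L w' (0, 0) → w = w' := by
  have hL := h.three_le
  have hL0 : (L : ℝ) ≠ 0 := by positivity
  induction n with
  | zero => intro w w' _; exact Subsingleton.elim _ _
  | succ n ih =>
    intro w w' e
    rw [PsiW_succ, PsiW_succ] at e
    have r1 := PsiW_range h (Fin.tail w)
    have r2 := PsiW_range h (Fin.tail w')
    simp only [Psi, Prod.mk.injEq] at e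
    obtain ⟨e1, e2⟩ := e
    rw [div_left_inj' hL0] at e1 e2
    obtain ⟨a1, a2⟩ := digit_eq r1.1 r2.1 e1
    obtain ⟨b1, b2⟩ := digit_eq r1.2 r2.2 e2
    have ht := ih _ _ (Prod.ext a2 b2)
    have h0 : w 0 = w' 0 := Subtype.ext (Prod.ext a1 b1)
    rw [← Fin.cons_self_tail w, ← Fin.cons_self_tail w', ht, h0]

lemma PsiW_inj (h : GoodCarpet L A) {n : ℕ} (p : ℝ × ℝ) (w w' : Word A n)
    (e : PsiW L w p = PsiW L w' p) : w = w' := by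
  rw [PsiW_affine h p w, PsiW_affine h p w'] at e
  simp only [Prod.mk.injEq, add_left_inj] at e
  exact PsiW_inj0 h w w' (Prod.ext e.1 e.2)

/-- The corners of the unit square in cyclic order. -/
noncomputable def cor : Fin 4 → ℝ × ℝ := ![(0, 0), (1, 0), (1, 1), (0, 1)]

lemma qf_eq (f : ℝ × ℝ → ℝ) : qf f = ∑ i : Fin 4, (f (cor i) - f (cor (i + 1))) ^ 2 := by
  simp [Fin.sum_univ_four, qf, cor]

lemma cor_mem (i : Fin 4) : cor i ∈ V0 := by
  rw [mem_V0]; fin_cases i <;> simp [cor]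

lemma cor_dist (i : Fin 4) : eudist (cor i) (cor (i + 1)) = 1 := by
  fin_cases i <;> simp [cor, eudist]

lemma cor_of_dist {p q : ℝ × ℝ} (hp : p ∈ V0) (hq : q ∈ V0) (hd : eudist p q = 1) :
    ∃ i : Fin 4, (p = cor i ∧ q = cor (i + 1)) ∨ (q = cor i ∧ p = cor (i + 1)) := by
  have hd2 : (p.1 - q.1) ^ 2 + (p.2 - q.2) ^ 2 = 1 := by
    unfold eudist at hd
    rwa [Real.sqrt_eq_one] at hd
  rw [mem_V0] at hp hq
  rcases hp with rfl | rfl | rfl | rfl <;> rcases hq with rfl | rfl | rfl | rfl <;>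
    norm_num at hd2
  · exact ⟨0, Or.inl (by simp [cor])⟩
  · exact ⟨3, Or.inr (by simp [cor])⟩
  · exact ⟨0, Or.inr (by simp [cor])⟩
  · exact ⟨1, Or.inl (by simp [cor])⟩
  · exact ⟨1, Or.inr (by simp [cor])⟩
  · exact ⟨2, Or.inl (by simp [cor])⟩
  · exact ⟨3, Or.inl (by simp [cor])⟩
  · exact ⟨2, Or.inr (by simp [cor])⟩

lemma mem_VN {n : ℕ} (w : Word A n) {p : ℝ × ℝ} (hp : p ∈ V0) : PsiW L w p ∈ VN L A n := by
  unfold VN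
  rw [Finset.mem_biUnion]
  exact ⟨w, Finset.mem_univ _, Finset.mem_image_of_mem _ hp⟩

lemma En_le_Dform (h : GoodCarpet L A) (n : ℕ) (f : ℝ × ℝ → ℝ) :
    En L A n f ≤ 8 * Dform L A n f := by
  have key : ∀ i : Fin 4,
      ∑ w : Word A n, (f (PsiW L w (cor i)) - f (PsiW L w (cor (i + 1)))) ^ 2 ≤
        2 * Dform L A n f := by
    intro i
    let φ : (ℝ × ℝ) × (ℝ × ℝ) → ℝ := fun z =>
      if Adj L A n z.1 z.2 then (f z.1 - f z.2) ^ 2 else 0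
    let g : Word A n → (ℝ × ℝ) × (ℝ × ℝ) := fun w => (PsiW L w (cor i), PsiW L w (cor (i + 1)))
    have e1 : ∀ w : Word A n, (f (PsiW L w (cor i)) - f (PsiW L w (cor (i + 1)))) ^ 2 = φ (g w) := by
      intro w
      have : Adj L A n (PsiW L w (cor i)) (PsiW L w (cor (i + 1))) :=
        ⟨w, _, cor_mem i, _, cor_mem (i + 1), cor_dist i, rfl, rfl⟩
      simp only [φ, g, if_pos this]
    have e2 : 2 * Dform L A n f = ∑ z ∈ VN L A n ×ˢ VN L A n, φ z := by
      rw [Finset.sum_product, Dform]; ring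
    rw [e2, Finset.sum_congr rfl fun w _ => e1 w,
      ← Finset.sum_image (f := φ) (g := g) (by
        intro w _ w' _ hw
        exact PsiW_inj h _ w w' (congrArg Prod.fst hw))]
    refine Finset.sum_le_sum_of_subset_of_nonneg ?_ ?_
    · intro z hz
      obtain ⟨w, _, rfl⟩ := Finset.mem_image.1 hz
      exact Finset.mem_product.2 ⟨mem_VN w (cor_mem _), mem_VN w (cor_mem _)⟩
    · intro z _ _
      simp only [φ]; split_ifs
      · positivity
      · exact le_rfl
  rw [En_eq_sum]
  simp only [qf_eq]
  rw [Finset.sum_comm]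
  calc _ ≤ ∑ _i : Fin 4, 2 * Dform L A n f := Finset.sum_le_sum fun i _ => key i
    _ = _ := by simp; ring

lemma Dform_le_En (n : ℕ) (f : ℝ × ℝ → ℝ) : Dform L A n f ≤ En L A n f := by
  let t : ℝ × ℝ → ℝ × ℝ → ℝ := fun x y => (f x - f y) ^ 2
  have ht : ∀ x y, 0 ≤ t x y := fun x y => sq_nonneg _
  let T : Word A n → Fin 4 → ℝ × ℝ → ℝ × ℝ → ℝ := fun w i x y =>
    (if x = PsiW L w (cor i) ∧ y = PsiW L w (cor (i + 1)) then t x y else 0) +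
      (if x = PsiW L w (cor (i + 1)) ∧ y = PsiW L w (cor i) then t x y else 0)
  have hT : ∀ w i x y, 0 ≤ T w i x y := by
    intro w i x y
    have := ht x y
    simp only [T]
    split_ifs <;> simp [this]
  have e1 : ∀ x y, (if Adj L A n x y then (f x - f y) ^ 2 else 0) ≤
      ∑ w : Word A n, ∑ i : Fin 4, T w i x y := by
    intro x y
    by_cases ha : Adj L A n x y
    · rw [if_pos ha]
      obtain ⟨w, p, hp, q, hq, hd, hx, hy⟩ := ha
      obtain ⟨i, hi⟩ := cor_of_dist hp hq hd
      have s1 : (f x - f y) ^ 2 ≤ T w i x y := by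
        have := ht x y
        simp only [T]
        rcases hi with ⟨rfl, rfl⟩ | ⟨rfl, rfl⟩
        · rw [if_pos ⟨hx, hy⟩]
          have : 0 ≤ (if x = PsiW L w (cor (i + 1)) ∧ y = PsiW L w (cor i) then t x y else 0) := by
            split_ifs <;> simp [this]
          simp only [t] at *
          linarith
        · rw [if_pos (c := x = PsiW L w (cor (i + 1)) ∧ y = PsiW L w (cor i)) ⟨hx, hy⟩]
          have : 0 ≤ (if x = PsiW L w (cor i) ∧ y = PsiW L w (cor (i + 1)) then t x y else 0) := by
            split_ifs <;> simp [this]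
          simp only [t] at *
          linarith
      have s2 : T w i x y ≤ ∑ i : Fin 4, T w i x y :=
        Finset.single_le_sum (f := fun i => T w i x y) (fun i _ => hT w i x y) (Finset.mem_univ i)
      have s3 : ∑ i : Fin 4, T w i x y ≤ ∑ w : Word A n, ∑ i : Fin 4, T w i x y :=
        Finset.single_le_sum (f := fun w => ∑ i : Fin 4, T w i x y)
          (fun w _ => Finset.sum_nonneg fun i _ => hT w i x y) (Finset.mem_univ w)
      linarith
    · rw [if_neg ha]
      exact Finset.sum_nonneg fun w _ => Finset.sum_nonneg fun i _ => hT w i x y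
  have e0 : ∀ a ∈ VN L A n, ∀ b ∈ VN L A n, ∑ x ∈ VN L A n, ∑ y ∈ VN L A n,
      (if x = a ∧ y = b then t x y else 0) = t a b := by
    intro a ha b hb
    simp [ite_and, ha, hb]
  have e2 : ∀ w : Word A n, ∀ i : Fin 4, ∑ x ∈ VN L A n, ∑ y ∈ VN L A n, T w i x y =
      2 * (f (PsiW L w (cor i)) - f (PsiW L w (cor (i + 1)))) ^ 2 := by
    intro w i
    simp only [T, Finset.sum_add_distrib]
    rw [e0 _ (mem_VN w (cor_mem _)) _ (mem_VN w (cor_mem _)),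
      e0 _ (mem_VN w (cor_mem _)) _ (mem_VN w (cor_mem _))]
    simp only [t]; ring
  have e3 : ∑ x ∈ VN L A n, ∑ y ∈ VN L A n, (if Adj L A n x y then (f x - f y) ^ 2 else 0) ≤
      ∑ x ∈ VN L A n, ∑ y ∈ VN L A n, ∑ w : Word A n, ∑ i : Fin 4, T w i x y :=
    Finset.sum_le_sum fun x _ => Finset.sum_le_sum fun y _ => e1 x y
  have e4 : ∑ x ∈ VN L A n, ∑ y ∈ VN L A n, ∑ w : Word A n, ∑ i : Fin 4, T w i x y =
      2 * En L A n f := by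
    rw [En_eq_sum, Finset.mul_sum]
    simp only [qf_eq, Finset.mul_sum]
    simp only [← e2]
    rw [Finset.sum_congr rfl fun x _ => Finset.sum_comm, Finset.sum_comm]
    refine Finset.sum_congr rfl fun w _ => ?_
    rw [Finset.sum_congr rfl fun x _ => Finset.sum_comm, Finset.sum_comm]
  unfold Dform
  linarith

/-- Corner-to-corner conductance for `Dform`. -/
noncomputable def dk (L : ℕ) (A : Finset (ℕ × ℕ)) (k : ℕ) : ℝ :=
  sInf {e : ℝ | ∃ f : ℝ × ℝ → ℝ, (∀ x ∈ ({((0 : ℝ), (0 : ℝ))} : Set (ℝ × ℝ)), f x = 1) ∧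
    (∀ x ∈ ({((1 : ℝ), (0 : ℝ))} : Set (ℝ × ℝ)), f x = 0) ∧ e = Dform L A k f}

lemma RR_eq (k : ℕ) : RR L A k = (dk L A k)⁻¹ := rfl

lemma sk_le_dk (h : GoodCarpet L A) (k : ℕ) : sk L A k ≤ 8 * dk L A k := by
  have : sk L A k / 8 ≤ dk L A k := by
    refine le_csInf ⟨_, fun x => (-1) * x.1 + 1, ?_, ?_, rfl⟩ ?_
    · rintro x rfl; simp
    · rintro x rfl; simp
    · rintro e ⟨f, h0, h1, rfl⟩
      have e1 := En_le_Dform h k f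
      have e2 := sk_le (L := L) (A := A) (k := k) (h0 _ rfl) (h1 _ rfl)
      linarith
  linarith

lemma dk_le_sk (h : GoodCarpet L A) (k : ℕ) : dk L A k ≤ sk L A k := by
  refine le_sk fun f h0 h1 => ?_
  refine le_trans (csInf_le ⟨0, ?_⟩ ⟨f, ?_, ?_, rfl⟩) (Dform_le_En k f)
  · rintro e ⟨f, -, -, rfl⟩
    have e1 := En_le_Dform h k f
    have e2 := En_nonneg (L := L) (A := A) k f
    linarith
  · rintro x rfl; exact h0
  · rintro x rfl; exact h1

/-- Theorem 3.3, planar case: multiplicative estimate for the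
resistance sequence `𝓡_n`. -/
theorem resistance_multiplicative (L : ℕ) (A : Finset (ℕ × ℕ)) (h : GoodCarpet L A) :
    ∃ c : ℝ, 1 ≤ c ∧ ∀ n m : ℕ, n ≤ m →
      c⁻¹ * (RR L A n * RR L A (m - n)) ≤ RR L A m ∧
      RR L A m ≤ c * (RR L A n * RR L A (m - n)) := by
  obtain ⟨C, hC, hes⟩ := ek_le_sk h
  refine ⟨512 * C + 32, by linarith, ?_⟩
  intro n m hnm
  obtain ⟨k, rfl⟩ := Nat.exists_eq_add_of_le' hnm
  rw [Nat.add_sub_cancel, RR_eq, RR_eq, RR_eq]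
  have dpos : ∀ j, 0 < dk L A j := fun j => by
    have := sk_pos h j
    have := sk_le_dk h j
    linarith
  have a1 := dpos n
  have a2 := dpos k
  have a3 := dpos (k + n)
  have s1 := sk_pos h n
  have s2 := sk_pos h k
  have hc : (0 : ℝ) < 512 * C + 32 := by linarith
  have up : dk L A (k + n) ≤ 512 * C * (dk L A n * dk L A k) := by
    calc dk L A (k + n) ≤ sk L A (k + n) := dk_le_sk h _
      _ ≤ 8 * ek L A k * sk L A n := sk_ext h k n
      _ ≤ 8 * (C * sk L A k) * sk L A n := by gcongr; exact hes k
      _ ≤ 8 * (C * (8 * dk L A k)) * (8 * dk L A n) := by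
          gcongr
          · exact sk_le_dk h k
          · exact sk_le_dk h n
      _ = _ := by ring
  have lo : dk L A n * dk L A k ≤ 32 * dk L A (k + n) := by
    calc dk L A n * dk L A k ≤ sk L A n * sk L A k :=
          mul_le_mul (dk_le_sk h n) (dk_le_sk h k) a2.le s1.le
      _ ≤ 4 * sk L A (k + n) := sk_mul h k n
      _ ≤ 32 * dk L A (k + n) := by have := sk_le_dk h (k + n); linarith
  have a4 : 0 < dk L A n * dk L A k := mul_pos a1 a2
  constructor
  · rw [← mul_inv, ← mul_inv]
    refine inv_anti₀ a3 ?_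
    linarith
  · rw [← mul_inv, ← div_eq_mul_inv, le_div_iff₀ a4, inv_mul_le_iff₀ a3]
    have := mul_pos hC a3
    linarith


end Carpet
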